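/- arXiv:1401.2696 — 6 statements merged into one kernel-verified Lean document; each statement's English description precedes it below -/
import Mathlib

section
/- If G is a finite simple graph of order n with minimum degree δ(G) ≥ √n, then G has a 2-proper partition 𝒫 with |𝒫| ≤ (n−1)/δ(G). -/
open SimpleGraph

/-- A graph is `k`-connected if the removal of any set of fewer than `k` vertices
results in a connected graph with at least two vertices. -/
def KConnected {V : Type*} (k : ℕ) (G : SimpleGraph V) : Prop :=
  ∀ S : Set V, S.ncard < k → (G.induce Sᶜ).Connected ∧ 2 ≤ Sᶜ.ncard

/-- A partition of the vertex set of `G` is `k`-proper if every part induces a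
`k`-connected subgraph. -/
def KProperPartition {V : Type*} [Fintype V] [DecidableEq V] (k : ℕ) (G : SimpleGraph V)
    (P : Finpartition (Finset.univ : Finset V)) : Prop :=
  ∀ p ∈ P.parts, KConnected k (G.induce (p : Set V))

/-- `S` cannot be split into two nonempty sets with no edge of `G` between them. -/
def Unsplit {V : Type*} [DecidableEq V] (G : SimpleGraph V) (S : Finset V) : Prop :=
  ∀ A B : Finset V, A.Nonempty → B.Nonempty → Disjoint A B → A ∪ B = S →
    ∃ a ∈ A, ∃ b ∈ B, G.Adj a b

/-- A finset inducing a `2`-connected subgraph, in terms of splittings. -/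
structure TwoConn {V : Type*} [DecidableEq V] (G : SimpleGraph V) (S : Finset V) : Prop where
  three_le : 3 ≤ S.card
  unsplit : Unsplit G S
  unsplit_erase : ∀ x ∈ S, Unsplit G (S.erase x)

/-- A family of disjoint `2`-connected subsets of `S` which covers `S \ E`. -/
structure TwoConnFamily {V : Type*} [DecidableEq V] (G : SimpleGraph V) (S E : Finset V)
    (F : Finset (Finset V)) : Prop where
  subset : ∀ P ∈ F, P ⊆ S
  twoConn : ∀ P ∈ F, TwoConn G P
  disjoint : ∀ P ∈ F, ∀ Q ∈ F, P ≠ Q → Disjoint P Q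
  cover : ∀ v ∈ S, v ∉ E → ∃ P ∈ F, v ∈ P

lemma card_filter_adj_lt {V : Type*} {G : SimpleGraph V} [DecidableRel G.Adj] {S : Finset V} {v : V} (hv : v ∈ S) :
    (S.filter (G.Adj v)).card < S.card :=
  Finset.card_lt_card (Finset.filter_ssubset.mpr ⟨v, hv, G.loopless.irrefl v⟩)

section

variable {V : Type*} [DecidableEq V] {G : SimpleGraph V}

lemma Unsplit.insert_vertex {S : Finset V} (hS : Unsplit G S) {y w : V} (hw : w ∈ S)
    (h : G.Adj y w) : Unsplit G (insert y S) := by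
  by_cases hy : y ∈ S
  · rwa [Finset.insert_eq_of_mem hy]
  have key : ∀ A B : Finset V, A.Nonempty → B.Nonempty → Disjoint A B → A ∪ B = insert y S →
      y ∈ A → ∃ a ∈ A, ∃ b ∈ B, G.Adj a b := by
    intro A B hA hB hd hu hyA
    by_cases hA' : (A.erase y).Nonempty
    · have hyB : y ∉ B := fun hb => Finset.disjoint_left.mp hd hyA hb
      obtain ⟨a, ha, b, hb, hab⟩ := hS (A.erase y) B hA' hB
        (hd.mono_left (Finset.erase_subset _ _)) (by
          ext v
          have := Finset.ext_iff.mp hu v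
          simp only [Finset.mem_union, Finset.mem_insert, Finset.mem_erase] at this ⊢
          grind)
      exact ⟨a, Finset.mem_of_mem_erase ha, b, hb, hab⟩
    · have hwu : w ∈ A ∪ B := hu ▸ Finset.mem_insert_of_mem hw
      have hwy : w ≠ y := fun e => hy (e ▸ hw)
      refine ⟨y, hyA, w, ?_, h⟩
      rcases Finset.mem_union.mp hwu with hwA | hwB
      · exact absurd ⟨w, Finset.mem_erase.mpr ⟨hwy, hwA⟩⟩ hA'
      · exact hwB
  intro A B hA hB hd hu
  have hyu : y ∈ A ∪ B := hu ▸ Finset.mem_insert_self _ _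
  rcases Finset.mem_union.mp hyu with hyA | hyB
  · exact key A B hA hB hd hu hyA
  · obtain ⟨b, hb, a, ha, hab⟩ :=
      key B A hB hA hd.symm (by rw [Finset.union_comm]; exact hu) hyB
    exact ⟨a, ha, b, hb, hab.symm⟩

lemma TwoConn.insert_vertex {S : Finset V} (hS : TwoConn G S) {y w z : V} (hw : w ∈ S) (hz : z ∈ S)
    (hwz : w ≠ z) (hyw : G.Adj y w) (hyz : G.Adj y z) : TwoConn G (insert y S) := by
  by_cases hy : y ∈ S
  · rwa [Finset.insert_eq_of_mem hy]
  refine ⟨hS.three_le.trans (Finset.card_le_card (Finset.subset_insert _ _)),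
    hS.unsplit.insert_vertex hw hyw, fun x hx => ?_⟩
  rcases Finset.mem_insert.mp hx with rfl | hxS
  · rw [Finset.erase_insert hy]
    exact hS.unsplit
  · have hxy : y ≠ x := fun e => hy (e ▸ hxS)
    rw [Finset.erase_insert_of_ne hxy]
    by_cases hxw : x = w
    · exact (hS.unsplit_erase x hxS).insert_vertex
        (Finset.mem_erase.mpr ⟨fun e => hwz (hxw.symm.trans e.symm), hz⟩) hyz
    · exact (hS.unsplit_erase x hxS).insert_vertex (Finset.mem_erase.mpr ⟨Ne.symm hxw, hw⟩) hyw

lemma Unsplit.connected {W : Type*} {H : SimpleGraph W} [Finite W] {S : Finset V}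
    (hS : Unsplit G S) (hne : S.Nonempty) (f : W → V) (hf : Function.Injective f)
    (hfS : ∀ v, v ∈ S ↔ ∃ w, f w = v) (hadj : ∀ a b, G.Adj (f a) (f b) → H.Adj a b) :
    H.Connected := by
  classical
  have := Fintype.ofFinite W
  obtain ⟨v₀, hv₀⟩ := hne
  obtain ⟨w₀, rfl⟩ := (hfS v₀).mp hv₀
  have : Nonempty W := ⟨w₀⟩
  refine ⟨fun u v => ?_⟩
  by_contra hv
  obtain ⟨a, ha, b, hb, hab⟩ := hS
    ((Finset.univ.filter fun w => H.Reachable u w).image f)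
    ((Finset.univ.filter fun w => ¬ H.Reachable u w).image f)
    ⟨f u, Finset.mem_image_of_mem f (by simp)⟩
    ⟨f v, Finset.mem_image_of_mem f (by simpa using hv)⟩
    ((Finset.disjoint_image hf).mpr (Finset.disjoint_filter_filter_not _ _ _))
    (by
      rw [← Finset.image_union, Finset.filter_union_filter_not_eq]
      ext v
      simp [hfS])
  obtain ⟨c, hc, rfl⟩ := Finset.mem_image.mp ha
  obtain ⟨d, hd, rfl⟩ := Finset.mem_image.mp hb
  simp only [Finset.mem_filter, Finset.mem_univ, true_and] at hc hd
  exact hd (hc.trans (hadj c d hab).reachable)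

lemma TwoConn.kConnected {S : Finset V} (hS : TwoConn G S) :
    KConnected 2 (G.induce (S : Set V)) := by
  intro T hT
  have hcard : T.ncard + Tᶜ.ncard = S.card := by
    rw [Set.ncard_add_ncard_compl, Nat.card_coe_set_eq, Set.ncard_coe_finset]
  have h3 := hS.three_le
  refine ⟨?_, by omega⟩
  have hf : Function.Injective (fun w : (Tᶜ : Set (S : Set V)) => (w : V)) :=
    fun a b h => Subtype.ext (Subtype.ext h)
  rcases (show T.ncard = 0 ∨ T.ncard = 1 by omega) with h0 | h1
  · have hTe : T = ∅ := (Set.ncard_eq_zero T.toFinite).mp h0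
    refine hS.unsplit.connected (Finset.card_pos.mp (by omega))
      (fun w : (Tᶜ : Set (S : Set V)) => (w : V)) hf (fun v => ?_) fun a b h => h
    constructor
    · intro hv
      exact ⟨⟨⟨v, hv⟩, by simp [hTe]⟩, rfl⟩
    · rintro ⟨w, rfl⟩
      exact w.1.2
  · obtain ⟨x, rfl⟩ := Set.ncard_eq_one.mp h1
    refine (hS.unsplit_erase x x.2).connected (Finset.card_pos.mp ?_)
      (fun w : (({x} : Set (S : Set V))ᶜ : Set (S : Set V)) => (w : V)) hf (fun v => ?_)
      fun a b h => h
    · rw [Finset.card_erase_of_mem x.2]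
      omega
    constructor
    · intro hv
      obtain ⟨hvx, hvS⟩ := Finset.mem_erase.mp hv
      exact ⟨⟨⟨v, hvS⟩, fun e => hvx (congrArg Subtype.val e)⟩, rfl⟩
    · rintro ⟨w, rfl⟩
      exact Finset.mem_erase.mpr ⟨fun e => w.2 (Subtype.ext e), w.1.2⟩

lemma TwoConnFamily.union {S T E E₁ E₂ : Finset V} {F₁ F₂ : Finset (Finset V)}
    (h₁ : TwoConnFamily G S E₁ F₁) (h₂ : TwoConnFamily G T E₂ F₂) (hd : Disjoint S T)
    (hE₁ : ∀ v ∈ S, v ∈ E₁ → v ∈ E) (hE₂ : ∀ v ∈ T, v ∈ E₂ → v ∈ E) :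
    TwoConnFamily G (S ∪ T) E (F₁ ∪ F₂) where
  subset P hP := (Finset.mem_union.mp hP).elim
    (fun h => (h₁.subset P h).trans Finset.subset_union_left)
    (fun h => (h₂.subset P h).trans Finset.subset_union_right)
  twoConn P hP := (Finset.mem_union.mp hP).elim (h₁.twoConn P) (h₂.twoConn P)
  disjoint P hP Q hQ hPQ := by
    rcases Finset.mem_union.mp hP with hP | hP <;> rcases Finset.mem_union.mp hQ with hQ | hQ
    · exact h₁.disjoint P hP Q hQ hPQ
    · exact hd.mono (h₁.subset P hP) (h₂.subset Q hQ)
    · exact hd.symm.mono (h₂.subset P hP) (h₁.subset Q hQ)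
    · exact h₂.disjoint P hP Q hQ hPQ
  cover v hv hvE := by
    rcases Finset.mem_union.mp hv with hvS | hvT
    · obtain ⟨P, hP, hvP⟩ := h₁.cover v hvS fun h => hvE (hE₁ v hvS h)
      exact ⟨P, Finset.mem_union_left _ hP, hvP⟩
    · obtain ⟨P, hP, hvP⟩ := h₂.cover v hvT fun h => hvE (hE₂ v hvT h)
      exact ⟨P, Finset.mem_union_right _ hP, hvP⟩

/-- A vertex with more neighbours outside `E` than there are parts can be added to some part. -/
lemma TwoConnFamily.exists_cover_vertex [DecidableRel G.Adj] {S E : Finset V} {y : V}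
    {F : Finset (Finset V)} (h : TwoConnFamily G S (insert y E) F) (hy : y ∈ S)
    (hdeg : y ∉ E → F.card + (E ∩ S).card < (S.filter (G.Adj y)).card) :
    ∃ F', TwoConnFamily G S E F' ∧ F'.card ≤ F.card := by
  by_cases hyE : y ∈ E
  · exact ⟨F, by rwa [Finset.insert_eq_of_mem hyE] at h, le_rfl⟩
  by_cases hyF : ∃ P ∈ F, y ∈ P
  · refine ⟨F, ⟨h.subset, h.twoConn, h.disjoint, fun v hv hvE => ?_⟩, le_rfl⟩
    by_cases hvy : v = y
    · exact hvy ▸ hyF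
    · exact h.cover v hv (by simp [hvy, hvE])
  push Not at hyF
  have hcov : ∀ v ∈ (S.filter (G.Adj y)) \ E, ∃ P ∈ F, v ∈ P := by
    intro v hv
    obtain ⟨hv, hvE⟩ := Finset.mem_sdiff.mp hv
    obtain ⟨hvS, hyv⟩ := Finset.mem_filter.mp hv
    exact h.cover v hvS (by simp [hvE, hyv.ne'])
  have hlt : F.card < ((S.filter (G.Adj y)) \ E).card := by
    have h1 := Finset.card_sdiff_add_card_inter (S.filter (G.Adj y)) E
    have h2 : ((S.filter (G.Adj y)) ∩ E).card ≤ (E ∩ S).card := by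
      apply Finset.card_le_card
      intro v hv
      simp only [Finset.mem_inter, Finset.mem_filter] at hv ⊢
      exact ⟨hv.2, hv.1.1⟩
    have := hdeg hyE
    omega
  choose! f hfF hfv using hcov
  obtain ⟨w, hw, z, hz, hwz, hfwz⟩ :=
    Finset.exists_ne_map_eq_of_card_lt_of_maps_to hlt (f := f) hfF
  have hyw : G.Adj y w := (Finset.mem_filter.mp (Finset.mem_sdiff.mp hw).1).2
  have hyz : G.Adj y z := (Finset.mem_filter.mp (Finset.mem_sdiff.mp hz).1).2
  set P := f w with hP
  have hPF : P ∈ F := hfF w hw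
  refine ⟨insert (insert y P) (F.erase P), ⟨?_, ?_, ?_, ?_⟩, ?_⟩
  · intro Q hQ
    rcases Finset.mem_insert.mp hQ with rfl | hQ
    · exact Finset.insert_subset hy (h.subset P hPF)
    · exact h.subset Q (Finset.mem_of_mem_erase hQ)
  · intro Q hQ
    rcases Finset.mem_insert.mp hQ with rfl | hQ
    · exact (h.twoConn P hPF).insert_vertex (hfv w hw) (hfwz ▸ hfv z hz) hwz hyw hyz
    · exact h.twoConn Q (Finset.mem_of_mem_erase hQ)
  · have key : ∀ Q ∈ F.erase P, Disjoint (insert y P) Q := by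
      intro Q hQ
      obtain ⟨hQP, hQF⟩ := Finset.mem_erase.mp hQ
      exact Finset.disjoint_insert_left.mpr ⟨hyF Q hQF, h.disjoint P hPF Q hQF (Ne.symm hQP)⟩
    intro Q hQ R hR hQR
    rcases Finset.mem_insert.mp hQ with rfl | hQ <;> rcases Finset.mem_insert.mp hR with rfl | hR
    · exact absurd rfl hQR
    · exact key R hR
    · exact (key Q hQ).symm
    · exact h.disjoint Q (Finset.mem_of_mem_erase hQ) R (Finset.mem_of_mem_erase hR) hQR
  · intro v hv hvE
    by_cases hvy : v = y
    · exact ⟨insert y P, Finset.mem_insert_self _ _, hvy ▸ Finset.mem_insert_self _ _⟩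
    · obtain ⟨Q, hQ, hvQ⟩ := h.cover v hv (by simp [hvy, hvE])
      by_cases hQP : Q = P
      · exact ⟨insert y P, Finset.mem_insert_self _ _, Finset.mem_insert_of_mem (hQP ▸ hvQ)⟩
      · exact ⟨Q, Finset.mem_insert_of_mem (Finset.mem_erase.mpr ⟨hQP, hQ⟩), hvQ⟩
  · refine (Finset.card_insert_le _ _).trans ?_
    rw [Finset.card_erase_add_one hPF]

lemma le_card_filter_adj_insert_right [DecidableRel G.Adj] {S A B : Finset V} {y v : V}
    {d : ℕ} (hS : S ⊆ insert y (A ∪ B)) (hAB : ∀ a ∈ A, ∀ b ∈ B, ¬ G.Adj a b) (hv : v ∈ A)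
    (hd : d ≤ (S.filter (G.Adj v)).card) : d ≤ ((insert y A).filter (G.Adj v)).card := by
  refine hd.trans (Finset.card_le_card fun w hw => ?_)
  obtain ⟨hwS, hvw⟩ := Finset.mem_filter.mp hw
  have := hS hwS
  have := hAB v hv w
  simp only [Finset.mem_insert, Finset.mem_union, Finset.mem_filter] at *
  grind

lemma sub_one_le_card_filter_adj [DecidableRel G.Adj] {A : Finset V} {y v : V}
    {d : ℕ} (hd : d ≤ ((insert y A).filter (G.Adj v)).card) :
    d - 1 ≤ (A.filter (G.Adj v)).card := by
  have h : (insert y A).filter (G.Adj v) ⊆ insert y (A.filter (G.Adj v)) := by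
    intro w
    simp only [Finset.mem_insert, Finset.mem_filter]
    tauto
  have := Finset.card_le_card h
  have := Finset.card_insert_le y (A.filter (G.Adj v))
  omega

/-- The counting step: one side of a cut vertex gets the vertex, the other one does not. -/
lemma exists_side_choice {d e a b α₁ α₂ : ℕ} {B₁ B₂ : ℕ → Prop}
    (hde : e + 2 ≤ d) (ha : d ≤ a) (hb : d ≤ b) (hab : a + b + 1 + d * e ≤ d * d)
    (hα₁ : α₁ * d ≤ a) (hα₂ : α₂ * d ≤ b)
    (hB₁ : a + (d - 1) * e ≤ (d - 1) * (d - 1) → ∃ β, β * (d - 1) + 1 ≤ a ∧ B₁ β)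
    (hB₂ : b + (d - 1) * e ≤ (d - 1) * (d - 1) → ∃ β, β * (d - 1) + 1 ≤ b ∧ B₂ β) :
    (∃ β, B₁ β ∧ (β + α₂) * d ≤ a + b) ∨ (∃ β, B₂ β ∧ (α₁ + β) * d ≤ a + b) := by
  obtain ⟨k, rfl⟩ : ∃ k, d = k + e + 2 := ⟨d - e - 2, by omega⟩
  have hd1 : k + e + 2 - 1 = k + e + 1 := by omega
  rw [hd1] at hB₁ hB₂
  have hk : 1 ≤ k := by
    by_contra hk
    have : k = 0 := by omega
    subst this
    nlinarith
  have small : ∀ x, x + 2 ≤ 2 * (k + e + 2) →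
      x + (k + e + 1) * e ≤ (k + e + 1) * (k + e + 1) := by
    intro x hx
    nlinarith
  have one : ∀ x β, x + 2 ≤ 2 * (k + e + 2) → β * (k + e + 1) + 1 ≤ x → β ≤ 1 := by
    intro x β hx hβ
    by_contra h
    have : 2 * (k + e + 1) ≤ β * (k + e + 1) := Nat.mul_le_mul_right _ (by omega)
    omega
  by_cases ha' : a + 2 ≤ 2 * (k + e + 2)
  · obtain ⟨β, hβ, hB⟩ := hB₁ (small a ha')
    have := one a β ha' hβ
    exact Or.inl ⟨β, hB, by nlinarith⟩
  by_cases hb' : b + 2 ≤ 2 * (k + e + 2)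
  · obtain ⟨β, hβ, hB⟩ := hB₂ (small b hb')
    have := one b β hb' hβ
    exact Or.inr ⟨β, hB, by nlinarith⟩
  obtain ⟨β₁, hβ₁, hB₁⟩ := hB₁ (by nlinarith)
  obtain ⟨β₂, hβ₂, hB₂⟩ := hB₂ (by nlinarith)
  by_cases h₁ : β₁ ≤ α₁
  · exact Or.inl ⟨β₁, hB₁, by nlinarith⟩
  by_cases h₂ : β₂ ≤ α₂
  · exact Or.inr ⟨β₂, hB₂, by nlinarith⟩
  refine Or.inr ⟨β₂, hB₂, ?_⟩
  have hsum : β₁ + β₂ ≤ k + e + 2 + 2 := by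
    by_contra hs
    have : (k + e + 5) * (k + e + 1) ≤ (β₁ + β₂) * (k + e + 1) :=
      Nat.mul_le_mul_right _ (by omega)
    nlinarith
  have : (α₁ + 1 + β₂) * (k + e + 2) ≤ (β₁ + β₂) * (k + e + 2) :=
    Nat.mul_le_mul_right _ (by omega)
  nlinarith

theorem exists_twoConnFamily [DecidableRel G.Adj] (N : ℕ) : ∀ (S E : Finset V) (d : ℕ),
    S.card ≤ N → S.Nonempty → (∀ v ∈ S, v ∉ E → d ≤ (S.filter (G.Adj v)).card) →
    S.card + d * (E ∩ S).card ≤ d * d →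
    ∃ F, TwoConnFamily G S E F ∧ F.card * d + 1 ≤ S.card := by
  induction N with
  | zero =>
    intro S E d hN hne
    exact absurd (Finset.card_pos.mpr hne) (by omega)
  | succ N ih =>
  intro S E d hN hne hdeg hsize
  by_cases hSE : S ⊆ E
  · exact ⟨∅, ⟨by simp, by simp, by simp, fun v hv hvE => absurd (hSE hv) hvE⟩,
      by simpa using hne⟩
  obtain ⟨v₀, hv₀, hv₀E⟩ := Finset.not_subset.mp hSE
  have hdS : d + 1 ≤ S.card := (hdeg v₀ hv₀ hv₀E).trans_lt (card_filter_adj_lt hv₀)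
  set e := (E ∩ S).card with he
  have hde : e + 2 ≤ d := by
    by_contra h
    have : d ≤ e + 1 := by omega
    nlinarith
  by_cases h2 : TwoConn G S
  · exact ⟨{S}, ⟨by simp, by simpa using h2, by simp, fun v hv _ => ⟨S, by simp, hv⟩⟩,
      by simpa using hdS⟩
  by_cases hun : Unsplit G S
  swap
  · -- `S` is disconnected
    unfold Unsplit at hun
    push Not at hun
    obtain ⟨A, B, hA, hB, hd, rfl, hAB⟩ := hun
    have hcard := Finset.card_union_of_disjoint hd
    have hA0 := Finset.card_pos.mpr hA
    have hB0 := Finset.card_pos.mpr hB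
    have hdegA : ∀ v ∈ A, v ∉ E → d ≤ (A.filter (G.Adj v)).card := by
      intro v hv hvE
      refine (hdeg v (Finset.mem_union_left _ hv) hvE).trans (Finset.card_le_card fun w hw => ?_)
      have := hAB v hv w
      simp only [Finset.mem_union, Finset.mem_filter] at *
      tauto
    have hdegB : ∀ v ∈ B, v ∉ E → d ≤ (B.filter (G.Adj v)).card := by
      intro v hv hvE
      refine (hdeg v (Finset.mem_union_right _ hv) hvE).trans
        (Finset.card_le_card fun w hw => ?_)
      have := fun hw => hAB w hw v hv
      have := G.adj_comm v w
      simp only [Finset.mem_union, Finset.mem_filter] at *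
      tauto
    have hEA : (E ∩ A).card ≤ e :=
      Finset.card_le_card (Finset.inter_subset_inter_left Finset.subset_union_left)
    have hEB : (E ∩ B).card ≤ e :=
      Finset.card_le_card (Finset.inter_subset_inter_left Finset.subset_union_right)
    obtain ⟨F₁, hF₁, hc₁⟩ := ih A E d (by omega) hA hdegA (by nlinarith)
    obtain ⟨F₂, hF₂, hc₂⟩ := ih B E d (by omega) hB hdegB (by nlinarith)
    refine ⟨F₁ ∪ F₂, hF₁.union hF₂ hd (fun _ _ h => h) (fun _ _ h => h), ?_⟩
    have := Nat.mul_le_mul_right d (Finset.card_union_le F₁ F₂)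
    nlinarith
  -- `S` has a cut vertex
  obtain ⟨y, hy, A, B, hA, hB, hd, hu, hAB⟩ : ∃ y ∈ S, ∃ A B : Finset V, A.Nonempty ∧
      B.Nonempty ∧ Disjoint A B ∧ A ∪ B = S.erase y ∧ ∀ a ∈ A, ∀ b ∈ B, ¬ G.Adj a b := by
    by_contra hcon
    push Not at hcon
    exact h2 ⟨by omega, hun, fun x hx A B hA hB hd hu => hcon x hx A B hA hB hd hu⟩
  have hyAB : y ∉ A ∪ B := by simp [hu]
  have hyA : y ∉ A := fun h => hyAB (Finset.mem_union_left _ h)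
  have hyB : y ∉ B := fun h => hyAB (Finset.mem_union_right _ h)
  have hS : S = insert y (A ∪ B) := by rw [hu, Finset.insert_erase hy]
  have hcard : S.card = A.card + B.card + 1 := by
    rw [hS, Finset.card_insert_of_notMem hyAB, Finset.card_union_of_disjoint hd]
  have hA0 := Finset.card_pos.mpr hA
  have hB0 := Finset.card_pos.mpr hB
  suffices hfam : ∃ F, TwoConnFamily G S (insert y E) F ∧ F.card * d + 1 ≤ S.card by
    obtain ⟨F, hF, hc⟩ := hfam
    obtain ⟨F', hF', hc'⟩ := hF.exists_cover_vertex hy (fun hyE => by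
      have := hdeg y hy hyE
      by_contra hlt
      have : d ≤ F.card + e := by omega
      nlinarith)
    exact ⟨F', hF', by nlinarith⟩
  have hdegA : ∀ v ∈ A, v ∉ E → d ≤ ((insert y A).filter (G.Adj v)).card := fun v hv hvE =>
    le_card_filter_adj_insert_right hS.subset hAB hv
      (hdeg v (hS ▸ Finset.mem_insert_of_mem (Finset.mem_union_left _ hv)) hvE)
  have hdegB : ∀ v ∈ B, v ∉ E → d ≤ ((insert y B).filter (G.Adj v)).card := fun v hv hvE =>
    le_card_filter_adj_insert_right (by rw [hS, Finset.union_comm])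
      (fun b hb a ha h => hAB a ha b hb h.symm) hv
      (hdeg v (hS ▸ Finset.mem_insert_of_mem (Finset.mem_union_right _ hv)) hvE)
  have hAS : A ⊆ S := hS ▸ Finset.subset_union_left.trans (Finset.subset_insert _ _)
  have hBS : B ⊆ S := hS ▸ Finset.subset_union_right.trans (Finset.subset_insert _ _)
  have hEA : (E ∩ A).card ≤ e := Finset.card_le_card (Finset.inter_subset_inter_left hAS)
  have hEB : (E ∩ B).card ≤ e := Finset.card_le_card (Finset.inter_subset_inter_left hBS)
  have hEAB : (E ∩ A).card + (E ∩ B).card ≤ e := by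
    rw [← Finset.card_union_of_disjoint
      (hd.mono Finset.inter_subset_right Finset.inter_subset_right),
      ← Finset.inter_union_distrib_left]
    exact Finset.card_le_card (Finset.inter_subset_inter_left (Finset.union_subset hAS hBS))
  -- the families for one side together with the cut vertex
  have side : ∀ C : Finset V, y ∉ C → (insert y C).card ≤ N →
      (∀ v ∈ C, v ∉ E → d ≤ ((insert y C).filter (G.Adj v)).card) →
      C.card + 1 + d * ((E ∩ C).card + 1) ≤ d * d →
      ∃ F, TwoConnFamily G (insert y C) (insert y E) F ∧ F.card * d ≤ C.card := by
    intro C hyC hCN hdegC hsz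
    have hins := Finset.card_insert_of_notMem hyC
    have hEC : (insert y E ∩ insert y C).card ≤ (E ∩ C).card + 1 := by
      rw [← Finset.insert_inter_distrib]
      exact Finset.card_insert_le _ _
    obtain ⟨F, hF, hc⟩ := ih (insert y C) (insert y E) d hCN (Finset.insert_nonempty _ _)
      (fun v hv hvE => by
        have hvy : v ≠ y := fun e => hvE (e ▸ Finset.mem_insert_self _ _)
        exact hdegC v (Finset.mem_of_mem_insert_of_ne hv hvy)
          fun h => hvE (Finset.mem_insert_of_mem h))
      (by nlinarith)
    exact ⟨F, hF, by omega⟩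
  have degenerate : ∀ C D : Finset V, C ⊆ E → S = insert y (C ∪ D) →
      (∃ F, TwoConnFamily G (insert y D) (insert y E) F ∧ F.card * d ≤ D.card) →
      D.card + 1 ≤ S.card → ∃ F, TwoConnFamily G S (insert y E) F ∧ F.card * d + 1 ≤ S.card := by
    rintro C D hCE hSD ⟨F, hF, hc⟩ hle
    refine ⟨F, ⟨fun P hP => (hF.subset P hP).trans ?_, hF.twoConn, hF.disjoint,
      fun v hv hvE => hF.cover v ?_ hvE⟩, by omega⟩
    · rw [hSD]
      exact Finset.insert_subset_insert _ Finset.subset_union_right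
    · rw [hSD] at hv
      have := @hCE v
      simp only [Finset.mem_insert, Finset.mem_union] at *
      tauto
  have hinsA := Finset.card_insert_of_notMem hyA
  have hinsB := Finset.card_insert_of_notMem hyB
  by_cases hAE : A ⊆ E
  · refine degenerate A B hAE hS (side B hyB (by omega) hdegB ?_) (by omega)
    have : (E ∩ A).card = A.card := by rw [Finset.inter_eq_right.mpr hAE]
    have : (E ∩ B).card + 1 ≤ e := by omega
    nlinarith
  by_cases hBE : B ⊆ E
  · refine degenerate B A hBE (by rw [hS, Finset.union_comm])
      (side A hyA (by omega) hdegA ?_) (by omega)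
    have : (E ∩ B).card = B.card := by rw [Finset.inter_eq_right.mpr hBE]
    have : (E ∩ A).card + 1 ≤ e := by omega
    nlinarith
  have large : ∀ C : Finset V, y ∉ C → ¬ C ⊆ E →
      (∀ v ∈ C, v ∉ E → d ≤ ((insert y C).filter (G.Adj v)).card) → d ≤ C.card := by
    intro C hyC hCE hdegC
    obtain ⟨v, hv, hvE⟩ := Finset.not_subset.mp hCE
    have h1 := hdegC v hv hvE
    have h2 := card_filter_adj_lt (G := G) (Finset.mem_insert_of_mem (b := y) hv)
    rw [Finset.card_insert_of_notMem hyC] at h2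
    omega
  have hdA := large A hyA hAE hdegA
  have hdB := large B hyB hBE hdegB
  obtain ⟨F₁, hF₁, hc₁⟩ := side A hyA (by omega) hdegA (by nlinarith)
  obtain ⟨F₂, hF₂, hc₂⟩ := side B hyB (by omega) hdegB (by nlinarith)
  have without : ∀ C : Finset V, C.Nonempty → C.card ≤ N → (E ∩ C).card ≤ e →
      (∀ v ∈ C, v ∉ E → d ≤ ((insert y C).filter (G.Adj v)).card) →
      C.card + (d - 1) * e ≤ (d - 1) * (d - 1) →
      ∃ β, β * (d - 1) + 1 ≤ C.card ∧ ∃ F, TwoConnFamily G C E F ∧ F.card = β := by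
    intro C hC hCN hCe hdegC hsz
    obtain ⟨F, hF, hc⟩ := ih C E (d - 1) hCN hC
      (fun v hv hvE => sub_one_le_card_filter_adj (hdegC v hv hvE))
      ((Nat.add_le_add_left (Nat.mul_le_mul_left _ hCe) _).trans hsz)
    exact ⟨F.card, hc, F, hF, rfl⟩
  rcases exists_side_choice hde hdA hdB (by omega) hc₁ hc₂
    (without A hA (by omega) hEA hdegA) (without B hB (by omega) hEB hdegB) with
    ⟨_, ⟨F, hF, rfl⟩, hle⟩ | ⟨_, ⟨F, hF, rfl⟩, hle⟩
  · refine ⟨F ∪ F₂, ?_, ?_⟩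
    · rw [hS, ← Finset.union_insert]
      exact hF.union hF₂ (Finset.disjoint_insert_right.mpr ⟨hyA, hd⟩)
        (fun _ _ h => Finset.mem_insert_of_mem h) (fun _ _ h => h)
    · have := Nat.mul_le_mul_right d (Finset.card_union_le F F₂)
      omega
  · refine ⟨F₁ ∪ F, ?_, ?_⟩
    · rw [hS, ← Finset.insert_union]
      exact hF₁.union hF (Finset.disjoint_insert_left.mpr ⟨hyB, hd⟩)
        (fun _ _ h => h) (fun _ _ h => Finset.mem_insert_of_mem h)
    · have := Nat.mul_le_mul_right d (Finset.card_union_le F₁ F)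
      omega

end

/-- **Theorem 1.** If `G` is a graph of order `n` with `δ(G) ≥ √n`, then `G` has a
`2`-proper partition with at most `(n-1)/δ(G)` parts. -/
theorem two_proper_partition {V : Type*} [Fintype V] [DecidableEq V]
    (G : SimpleGraph V) [DecidableRel G.Adj]
    (hδ : (G.minDegree : ℝ) ≥ Real.sqrt (Fintype.card V : ℝ)) :
    ∃ P : Finpartition (Finset.univ : Finset V), KProperPartition 2 G P ∧
      (P.parts.card : ℝ) ≤ ((Fintype.card V : ℝ) - 1) / (G.minDegree : ℝ) := by
  rcases isEmpty_or_nonempty V with hV | hV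
  · refine ⟨⊥, fun p hp => ?_, ?_⟩
    · simp at hp
    · simp
  have hsq : Fintype.card V ≤ G.minDegree * G.minDegree := by
    have := (Real.sqrt_le_left (Nat.cast_nonneg G.minDegree)).mp hδ
    rw [sq] at this
    exact_mod_cast this
  obtain ⟨F, hF, hc⟩ := exists_twoConnFamily (G := G) (Fintype.card V) Finset.univ ∅ G.minDegree
    le_rfl Finset.univ_nonempty
    (fun v _ _ => by
      rw [← G.neighborFinset_eq_filter, G.card_neighborFinset_eq_degree]
      exact G.minDegree_le_degree v)
    (by simpa using hsq)
  have hpos : 0 < G.minDegree := by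
    have := Fintype.card_pos (α := V)
    exact Nat.pos_of_ne_zero fun h => by simp [h] at hsq
  refine ⟨⟨F, ?_, ?_, ?_⟩, fun p hp => (hF.twoConn p hp).kConnected, ?_⟩
  · rw [Finset.supIndep_iff_pairwiseDisjoint]
    exact fun P hP Q hQ h => hF.disjoint P hP Q hQ h
  · refine Finset.eq_univ_of_forall fun v => ?_
    obtain ⟨P, hP, hv⟩ := hF.cover v (Finset.mem_univ v) (Finset.notMem_empty v)
    exact Finset.mem_sup.mpr ⟨P, hP, hv⟩
  · intro h
    have := (hF.twoConn _ h).three_le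
    simp at this
  · rw [le_div_iff₀ (by exact_mod_cast hpos), le_sub_iff_add_le]
    exact_mod_cast hc
end

section
/- Let k ≥ 2 be an integer. If G is a finite simple graph of order n with minimum degree δ(G) ≥ √((2123/180)(k−1)n), then G has a k-proper partition 𝒫 with |𝒫| ≤ 2123n/(180·δ(G)). -/
open SimpleGraph

/-- A finset `p` of more than `k` vertices such that any two disjoint nonempty subsets of `p`
missing fewer than `k` vertices of `p` are joined by an edge. -/
def FinsetKConnected {V : Type*} (k : ℕ) (G : SimpleGraph V) (p : Finset V) : Prop :=
  k < p.card ∧ ∀ A B : Finset V, A ⊆ p → B ⊆ p → Disjoint A B → A.Nonempty → B.Nonempty →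
    p.card < A.card + B.card + k → ∃ a ∈ A, ∃ b ∈ B, G.Adj a b

theorem FinsetKConnected.kConnected_induce {V : Type*} {k : ℕ} {G : SimpleGraph V}
    {p : Finset V} (h : FinsetKConnected k G p) : KConnected k (G.induce (p : Set V)) := by
  classical
  intro S hS
  have hcard : Sᶜ.ncard + S.ncard = p.card := by
    rw [add_comm, Set.ncard_add_ncard_compl, Nat.card_eq_fintype_card]
    simp
  have h1 := h.1
  refine ⟨?_, by omega⟩
  have hne : Sᶜ.Nonempty := by
    rw [← Set.ncard_pos]
    omega
  have : Nonempty ↥Sᶜ := hne.to_subtype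
  refine ⟨fun x y => ?_⟩
  by_contra hxy
  let H := (G.induce (p : Set V)).induce Sᶜ
  let f : ↥Sᶜ → V := fun z => z.1.1
  have hf : Function.Injective f := Subtype.val_injective.comp Subtype.val_injective
  let X : Finset ↥Sᶜ := Finset.univ.filter fun z => H.Reachable x z
  have hsub : ∀ Y : Finset ↥Sᶜ, Y.image f ⊆ p := by
    intro Y z hz
    obtain ⟨w, -, rfl⟩ := Finset.mem_image.1 hz
    exact w.1.2
  have hX : X.card + Xᶜ.card = Sᶜ.ncard := by
    rw [Finset.card_add_card_compl, ← Nat.card_eq_fintype_card]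
    rfl
  obtain ⟨a, ha, b, hb, hab⟩ := h.2 (X.image f) (Xᶜ.image f) (hsub _) (hsub _)
    ((Finset.disjoint_image hf).2 disjoint_compl_right)
    (Finset.Nonempty.image ⟨x, by simp [X]⟩ f)
    (Finset.Nonempty.image ⟨y, Finset.mem_compl.2 fun hy => hxy (Finset.mem_filter.1 hy).2⟩ f)
    (by rw [Finset.card_image_of_injective _ hf, Finset.card_image_of_injective _ hf]; omega)
  obtain ⟨a, haX, rfl⟩ := Finset.mem_image.1 ha
  obtain ⟨b, hbX, rfl⟩ := Finset.mem_image.1 hb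
  have ha' : H.Reachable x a := (Finset.mem_filter.1 haX).2
  have hab' : H.Adj a b := hab
  exact Finset.mem_compl.1 hbX (Finset.mem_filter.2 ⟨Finset.mem_univ _, ha'.trans hab'.reachable⟩)

theorem FinsetKConnected.insert_vertex {V : Type*} [DecidableEq V] {k : ℕ} {G : SimpleGraph V}
    [DecidableRel G.Adj] {p : Finset V} (h : FinsetKConnected k G p) {v : V} (hv : v ∉ p)
    (hk : k ≤ (p.filter (G.Adj v)).card) : FinsetKConnected k G (insert v p) := by
  have key : ∀ A B : Finset V, A ⊆ insert v p → B ⊆ insert v p → Disjoint A B →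
      A.Nonempty → B.Nonempty → (insert v p).card < A.card + B.card + k → v ∈ A →
      ∃ a ∈ A, ∃ b ∈ B, G.Adj a b := by
    intro A B hA hB hAB _ hBne hcard hvA
    rw [Finset.card_insert_of_notMem hv] at hcard
    have hBp : B ⊆ p := (Finset.subset_insert_iff_of_notMem
      (Finset.disjoint_left.1 hAB hvA)).1 hB
    have hAe := Finset.card_erase_add_one hvA
    by_cases hA' : (A.erase v).Nonempty
    · obtain ⟨a, ha, b, hb, hab⟩ := h.2 (A.erase v) B (Finset.subset_insert_iff.1 hA) hBp
        (hAB.mono_left (Finset.erase_subset _ _)) hA' hBne (by omega)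
      exact ⟨a, Finset.mem_of_mem_erase ha, b, hb, hab⟩
    · rw [Finset.not_nonempty_iff_eq_empty] at hA'
      rw [hA', Finset.card_empty] at hAe
      by_contra! hno
      have hdisj : Disjoint B (p.filter (G.Adj v)) :=
        Finset.disjoint_left.2 fun b hb hb' => hno v hvA b hb (Finset.mem_filter.1 hb').2
      have := Finset.card_le_card (Finset.union_subset hBp (Finset.filter_subset (G.Adj v) p))
      rw [Finset.card_union_of_disjoint hdisj] at this
      omega
  refine ⟨h.1.trans_le (Finset.card_le_card (Finset.subset_insert _ _)), ?_⟩
  intro A B hA hB hAB hAne hBne hcard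
  by_cases hvA : v ∈ A
  · exact key A B hA hB hAB hAne hBne hcard hvA
  by_cases hvB : v ∈ B
  · obtain ⟨b, hb, a, ha, hab⟩ := key B A hB hA hAB.symm hBne hAne (by omega) hvB
    exact ⟨a, ha, b, hb, hab.symm⟩
  · have := Finset.card_le_card (Finset.subset_insert v p)
    exact h.2 A B ((Finset.subset_insert_iff_of_notMem hvA).1 hA)
      ((Finset.subset_insert_iff_of_notMem hvB).1 hB) hAB hAne hBne (by omega)

theorem card_interedges_self_eq_sum {V : Type*} [DecidableEq V] (G : SimpleGraph V)
    [DecidableRel G.Adj] (A : Finset V) :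
    (G.interedges A A).card = ∑ v ∈ A, (A.filter (G.Adj v)).card := by
  simp only [SimpleGraph.interedges, Rel.interedges, Finset.card_filter, Finset.sum_product]

theorem card_interedges_self_le_erase {V : Type*} [DecidableEq V] (G : SimpleGraph V)
    [DecidableRel G.Adj] (A : Finset V) (v : V) :
    (G.interedges A A).card ≤
      (G.interedges (A.erase v) (A.erase v)).card + 2 * (A.filter (G.Adj v)).card := by
  have hsub : G.interedges A A ⊆ G.interedges (A.erase v) (A.erase v) ∪
      (({v} ×ˢ A.filter (G.Adj v)) ∪ (A.filter (G.Adj v) ×ˢ {v})) := by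
    rintro ⟨x, y⟩ hxy
    rw [SimpleGraph.mem_interedges_iff] at hxy
    obtain ⟨hx, hy, hadj⟩ := hxy
    simp only [Finset.mem_union, SimpleGraph.mem_interedges_iff, Finset.mem_erase,
      Finset.mem_product, Finset.mem_singleton, Finset.mem_filter]
    by_cases hxv : x = v
    · subst hxv; tauto
    · by_cases hyv : y = v
      · subst hyv; have := hadj.symm; tauto
      · tauto
  have h1 := Finset.card_le_card hsub
  have h2 := Finset.card_union_le (G.interedges (A.erase v) (A.erase v))
    (({v} ×ˢ A.filter (G.Adj v)) ∪ (A.filter (G.Adj v) ×ˢ {v}))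
  have h3 := Finset.card_union_le ({v} ×ˢ A.filter (G.Adj v)) (A.filter (G.Adj v) ×ˢ {v})
  simp only [Finset.card_product, Finset.card_singleton] at h3
  omega

theorem card_interedges_self_le_of_not_adj {V : Type*} [DecidableEq V] (G : SimpleGraph V)
    [DecidableRel G.Adj] {H A B : Finset V} (hAB : ∀ a ∈ A, ∀ b ∈ B, ¬ G.Adj a b)
    (hdisj : Disjoint A B) :
    (G.interedges H H).card ≤ (G.interedges (H \ A) (H \ A)).card +
      (G.interedges (H \ B) (H \ B)).card := by
  refine le_trans (Finset.card_le_card ?_) (Finset.card_union_le _ _)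
  rintro ⟨x, y⟩ hxy
  rw [SimpleGraph.mem_interedges_iff] at hxy
  obtain ⟨hx, hy, hadj⟩ := hxy
  have h1 := hAB x
  have h2 := hAB y
  have h3 := fun h : x ∈ A => Finset.disjoint_left.1 hdisj h
  have h4 := fun h : y ∈ A => Finset.disjoint_left.1 hdisj h
  have h5 := hadj.symm
  simp only [Finset.mem_union, SimpleGraph.mem_interedges_iff, Finset.mem_sdiff]
  by_cases hxA : x ∈ A
  · have h6 : y ∉ B := fun h => h1 hxA y h hadj
    tauto
  · by_cases hyA : y ∈ A
    · have h6 : x ∉ B := fun h => h2 hyA x h h5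
      tauto
    · tauto

/-- Mader: a nonempty set inducing minimum degree at least `d ≥ 4 * K` contains a
`(K + 1)`-connected set with more than `d / 2` vertices. -/
theorem exists_finsetKConnected_of_le_degree {V : Type*} [DecidableEq V] (G : SimpleGraph V)
    [DecidableRel G.Adj] {K d : ℕ} (hK : 1 ≤ K) (hd : 4 * K ≤ d) {R : Finset V}
    (hR : R.Nonempty) (hdeg : ∀ v ∈ R, d ≤ (R.filter (G.Adj v)).card) :
    ∃ H ⊆ R, FinsetKConnected (K + 1) G H ∧ d < 2 * H.card := by
  have hdegree_lt : ∀ (H : Finset V), ∀ v ∈ H, (H.filter (G.Adj v)).card < H.card := by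
    intro H v hv
    exact Finset.card_lt_card (Finset.filter_ssubset.2 ⟨v, hv, G.loopless.irrefl v⟩)
  let Dense : Finset V → Prop := fun A =>
    2 * K ≤ A.card ∧ d * A.card < (G.interedges A A).card + d * K
  have hdK : 0 < d * K := Nat.mul_pos (by omega) hK
  have hRdense : Dense R := by
    obtain ⟨v, hv⟩ := hR
    have h1 := hdeg v hv
    have h2 := hdegree_lt R v hv
    refine ⟨by omega, ?_⟩
    have h3 := Finset.card_nsmul_le_sum R (fun v => (R.filter (G.Adj v)).card) d hdeg
    rw [← card_interedges_self_eq_sum, smul_eq_mul, mul_comm] at h3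
    omega
  obtain ⟨H, hH, hmin⟩ := Finset.exists_min_image (R.powerset.filter Dense) Finset.card
    ⟨R, by simpa using hRdense⟩
  simp only [Finset.mem_filter, Finset.mem_powerset] at hH hmin
  obtain ⟨hHR, hH1, hH2⟩ := hH
  have hsmall : ∀ A ⊆ H, A.card < H.card → 2 * K ≤ A.card →
      (G.interedges A A).card + d * K ≤ d * A.card := by
    intro A hA hlt hA2
    by_contra! hcon
    have := hmin A ⟨hA.trans hHR, hA2, hcon⟩
    omega
  have hH3 : 2 * K < H.card := by
    refine lt_of_le_of_ne hH1 fun heq => ?_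
    have h1 := Finset.sum_le_card_nsmul H (fun v => (H.filter (G.Adj v)).card) (2 * K)
      fun v hv => by have := hdegree_lt H v hv; omega
    rw [← card_interedges_self_eq_sum, smul_eq_mul, ← heq] at h1
    rw [← heq] at hH2
    nlinarith
  have hHdeg : ∀ v ∈ H, d < 2 * (H.filter (G.Adj v)).card := by
    intro v hv
    have h1 := Finset.card_erase_add_one hv
    have h2 := hsmall (H.erase v) (Finset.erase_subset _ _) (by omega) (by omega)
    have h3 := card_interedges_self_le_erase G H v
    rw [← h1, mul_add] at hH2
    omega
  have hHne : H.Nonempty := Finset.card_pos.1 (by omega)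
  obtain ⟨w, hw⟩ := hHne
  have hw1 := hHdeg w hw
  have hw2 := hdegree_lt H w hw
  refine ⟨H, hHR, ⟨by omega, ?_⟩, by omega⟩
  intro A B hA hB hAB hAne hBne hcard
  by_contra! hno
  have hside : ∀ A B : Finset V, A ⊆ H → B ⊆ H → Disjoint A B → A.Nonempty → B.Nonempty →
      (∀ a ∈ A, ∀ b ∈ B, ¬ G.Adj a b) →
      (G.interedges (H \ B) (H \ B)).card + d * K ≤ d * (H \ B).card := by
    intro A B hA hB hAB ⟨a, ha⟩ hBne hno
    have h1 : H.filter (G.Adj a) ⊆ H \ B := by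
      intro x hx
      rw [Finset.mem_filter] at hx
      exact Finset.mem_sdiff.2 ⟨hx.1, fun hxB => hno a ha x hxB hx.2⟩
    have h2 := Finset.card_le_card h1
    have h3 := hHdeg a (hA ha)
    exact hsmall _ Finset.sdiff_subset (Finset.card_lt_card (Finset.sdiff_ssubset hB hBne))
      (by omega)
  have h1 := hside A B hA hB hAB hAne hBne hno
  have h2 := hside B A hB hA hAB.symm hBne hAne fun b hb a ha h => hno a ha b hb h.symm
  have h3 := card_interedges_self_le_of_not_adj G (H := H) hno hAB
  have h4 := Finset.card_sdiff_add_card_eq_card hA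
  have h5 := Finset.card_sdiff_add_card_eq_card hB
  have h6 : (H \ A).card + (H \ B).card ≤ H.card + K := by omega
  have h7 := Nat.mul_le_mul_left d h6
  rw [mul_add, mul_add] at h7
  omega

/-- Disjoint `k`-connected vertex sets, each of size at least a quarter of `δ`. -/
structure IsLargePacking {V : Type*} (k δ : ℕ) (G : SimpleGraph V)
    (F : Finset (Finset V)) : Prop where
  pairwiseDisjoint : (F : Set (Finset V)).PairwiseDisjoint id
  finsetKConnected : ∀ p ∈ F, FinsetKConnected k G p
  le_card : ∀ p ∈ F, δ ≤ 4 * p.card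

theorem IsLargePacking.insert_part {V : Type*} [DecidableEq V] {k δ : ℕ} {G : SimpleGraph V}
    {F : Finset (Finset V)} (h : IsLargePacking k δ G F) {p : Finset V}
    (hp : FinsetKConnected k G p) (hδ : δ ≤ 4 * p.card) (hdisj : ∀ q ∈ F, Disjoint p q) :
    IsLargePacking k δ G (insert p F) where
  pairwiseDisjoint := by
    rw [Finset.coe_insert]
    exact h.pairwiseDisjoint.insert fun q hq _ => hdisj q hq
  finsetKConnected := Finset.forall_mem_insert _ _ _ |>.2 ⟨hp, h.finsetKConnected⟩
  le_card := Finset.forall_mem_insert _ _ _ |>.2 ⟨hδ, h.le_card⟩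

theorem IsLargePacking.mono {V : Type*} {k δ : ℕ} {G : SimpleGraph V}
    {F F' : Finset (Finset V)} (h : IsLargePacking k δ G F) (hF : F' ⊆ F) :
    IsLargePacking k δ G F' where
  pairwiseDisjoint := h.pairwiseDisjoint.subset (Finset.coe_subset.2 hF)
  finsetKConnected p hp := h.finsetKConnected p (hF hp)
  le_card p hp := h.le_card p (hF hp)

theorem IsLargePacking.card_mul_le {V : Type*} [Fintype V] [DecidableEq V] {k δ : ℕ}
    {G : SimpleGraph V} {F : Finset (Finset V)} (h : IsLargePacking k δ G F) :
    F.card * δ ≤ 4 * Fintype.card V := by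
  have h1 := Finset.card_nsmul_le_sum F (fun p => 4 * p.card) δ h.le_card
  rw [← Finset.mul_sum, smul_eq_mul] at h1
  have h2 : (F.biUnion id).card = ∑ p ∈ F, p.card := Finset.card_biUnion h.pairwiseDisjoint
  have h3 := Finset.card_le_univ (F.biUnion id)
  omega

theorem IsLargePacking.exists_larger {V : Type*} [Fintype V] [DecidableEq V] {K : ℕ}
    (hK : 1 ≤ K) {G : SimpleGraph V} [DecidableRel G.Adj]
    (hδ : 11 * (K * Fintype.card V) ≤ G.minDegree ^ 2) {F : Finset (Finset V)}
    (h : IsLargePacking (K + 1) G.minDegree G F) (hF : F.biUnion id ≠ Finset.univ) :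
    ∃ F', IsLargePacking (K + 1) G.minDegree G F' ∧
      (F.biUnion id).card < (F'.biUnion id).card := by
  set R := (F.biUnion id)ᶜ with hR
  have hmemR : ∀ v, v ∈ R ↔ ∀ p ∈ F, v ∉ p := by simp [hR]
  have hRne : R.Nonempty := by
    rw [Finset.nonempty_iff_ne_empty]
    simpa [hR] using hF
  by_cases habs : ∃ v ∈ R, ∃ p ∈ F, K + 1 ≤ (p.filter (G.Adj v)).card
  · obtain ⟨v, hv, p, hp, hvp⟩ := habs
    have hv' := (hmemR v).1 hv
    refine ⟨insert (insert v p) (F.erase p),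
      (h.mono (Finset.erase_subset p F)).insert_part
        ((h.finsetKConnected p hp).insert_vertex (hv' p hp) hvp) ?_ ?_, ?_⟩
    · have := h.le_card p hp
      have := Finset.card_le_card (Finset.subset_insert v p)
      omega
    · intro q hq
      obtain ⟨hqp, hqF⟩ := Finset.mem_erase.1 hq
      exact Finset.disjoint_insert_left.2 ⟨hv' q hqF, h.pairwiseDisjoint hp hqF hqp.symm⟩
    · refine Finset.card_lt_card (Finset.ssubset_iff.2 ⟨v, Finset.mem_compl.1 hv, ?_⟩)
      intro x hx
      simp only [Finset.mem_insert, Finset.mem_biUnion, id] at hx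
      simp only [Finset.mem_biUnion, Finset.mem_insert, Finset.mem_erase, id]
      rcases hx with rfl | ⟨q, hq, hxq⟩
      · exact ⟨_, Or.inl rfl, Finset.mem_insert_self _ _⟩
      · by_cases hqp : q = p
        · exact ⟨_, Or.inl rfl, Finset.mem_insert_of_mem (hqp ▸ hxq)⟩
        · exact ⟨q, Or.inr ⟨hqp, hq⟩, hxq⟩
  · push Not at habs
    obtain ⟨v₀, hv₀⟩ := hRne
    have hn : 0 < Fintype.card V := Fintype.card_pos_iff.2 ⟨v₀⟩
    have hlt : G.minDegree < Fintype.card V :=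
      (G.minDegree_le_degree v₀).trans_lt (G.degree_lt_card_verts v₀)
    have hKδ : 11 * K ≤ G.minDegree := by
      by_contra! hcon
      nlinarith
    have hpos : 0 < G.minDegree := by omega
    have hKF : 11 * (K * F.card) ≤ 4 * G.minDegree := by
      refine Nat.le_of_mul_le_mul_right ?_ hpos
      have := Nat.mul_le_mul_left (11 * K) h.card_mul_le
      nlinarith
    have hdeg : ∀ v ∈ R, G.minDegree - K * F.card ≤ (R.filter (G.Adj v)).card := by
      intro v hv
      have h1 := G.minDegree_le_degree v
      have hsub : G.neighborFinset v ⊆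
          R.filter (G.Adj v) ∪ F.biUnion fun p => p.filter (G.Adj v) := by
        intro x hx
        rw [SimpleGraph.mem_neighborFinset] at hx
        simp only [Finset.mem_union, Finset.mem_filter, Finset.mem_biUnion, hmemR]
        by_cases hxF : ∀ p ∈ F, x ∉ p
        · exact Or.inl ⟨hxF, hx⟩
        · push Not at hxF
          obtain ⟨p, hp, hxp⟩ := hxF
          exact Or.inr ⟨p, hp, hxp, hx⟩
      have h2 := (Finset.card_le_card hsub).trans (Finset.card_union_le _ _)
      rw [SimpleGraph.card_neighborFinset_eq_degree] at h2
      have h3 := Finset.card_biUnion_le_card_mul F (fun p => p.filter (G.Adj v)) K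
        fun p hp => Nat.lt_succ_iff.1 (habs v hv p hp)
      rw [mul_comm] at h3
      omega
    obtain ⟨H, hHR, hH, hHcard⟩ :=
      exists_finsetKConnected_of_le_degree G hK (by omega) ⟨v₀, hv₀⟩ hdeg
    refine ⟨insert H F, h.insert_part hH (by omega) fun q hq =>
      Finset.disjoint_left.2 fun x hx => (hmemR x).1 (hHR hx) q hq, ?_⟩
    rw [Finset.biUnion_insert, id, Finset.card_union_of_disjoint
      (Finset.disjoint_left.2 fun x hx => Finset.mem_compl.1 (hHR hx))]
    have := hH.1
    omega

/-- **Theorem 2.** If `k ≥ 2` and `G` is a graph of order `n` with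
`δ(G) ≥ √((2123/180)(k-1)n)`, then `G` has a `k`-proper partition with at most
`2123 n / (180 δ(G))` parts. -/
theorem k_proper_partition {V : Type*} [Fintype V] [DecidableEq V] (k : ℕ) (hk : 2 ≤ k)
    (G : SimpleGraph V) [DecidableRel G.Adj]
    (hδ : (G.minDegree : ℝ) ≥
      Real.sqrt ((2123 / 180) * ((k : ℝ) - 1) * (Fintype.card V : ℝ))) :
    ∃ P : Finpartition (Finset.univ : Finset V), KProperPartition k G P ∧
      (P.parts.card : ℝ) ≤ 2123 * (Fintype.card V : ℝ) / (180 * (G.minDegree : ℝ)) := by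
  classical
  obtain ⟨K, rfl⟩ : ∃ K, k = K + 1 := ⟨k - 1, by omega⟩
  have hK : 1 ≤ K := by omega
  have hδ' : 11 * (K * Fintype.card V) ≤ G.minDegree ^ 2 := by
    have h1 := (Real.sqrt_le_left (Nat.cast_nonneg _)).1 hδ
    push_cast at h1
    have h2 : (0 : ℝ) ≤ K * Fintype.card V := by positivity
    have h3 : (11 * (K * Fintype.card V) : ℝ) ≤ (G.minDegree : ℝ) ^ 2 := by nlinarith
    exact_mod_cast h3
  obtain ⟨F, hF, hmax⟩ := Finset.exists_max_image
    (Finset.univ.filter (IsLargePacking (K + 1) G.minDegree G)) (fun F => (F.biUnion id).card)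
    ⟨∅, Finset.mem_filter.2 ⟨Finset.mem_univ _, by constructor <;> simp⟩⟩
  simp only [Finset.mem_filter, Finset.mem_univ, true_and] at hF hmax
  have hcover : F.biUnion id = Finset.univ := by
    by_contra hne
    obtain ⟨F', hF', hlt⟩ := hF.exists_larger hK hδ' hne
    exact absurd (hmax F' hF') (by omega)
  let P : Finpartition (Finset.univ : Finset V) :=
    { parts := F
      supIndep := Finset.supIndep_iff_pairwiseDisjoint.2 hF.pairwiseDisjoint
      sup_parts := by rw [Finset.sup_eq_biUnion, hcover]
      bot_notMem := fun h => by simpa using (hF.finsetKConnected _ h).1 }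
  refine ⟨P, fun p hp => (hF.finsetKConnected p hp).kConnected_induce, ?_⟩
  rcases Nat.eq_zero_or_pos G.minDegree with h0 | hpos
  · have hn : Fintype.card V = 0 := by
      rw [h0] at hδ'
      by_contra hne
      have := Nat.mul_pos hK (Nat.pos_of_ne_zero hne)
      omega
    have h1 := P.card_parts_le_card
    rw [Finset.card_univ, hn, Nat.le_zero] at h1
    simp [h1, hn]
  · have hpos' : (0 : ℝ) < G.minDegree := by exact_mod_cast hpos
    rw [le_div_iff₀ (by positivity)]
    have h1 : (F.card * G.minDegree : ℝ) ≤ 4 * Fintype.card V := by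
      exact_mod_cast hF.card_mul_le
    have h2 : (0 : ℝ) ≤ Fintype.card V := by positivity
    change (F.card : ℝ) * _ ≤ _
    nlinarith
end

section
/- Let G be a finite simple graph on n ≥ 1 vertices with average degree d̄ = 2|E(G)|/n, and set k = ⌊60·d̄/193⌋. If k ≥ 1, then G contains a k-connected subgraph. -/
open SimpleGraph

section PairCount

open Finset Classical

variable {V : Type*} (G : SimpleGraph V)

/-- The number of ordered adjacent pairs in `X × Y`, as a real number. -/
noncomputable def adjPairs (X Y : Finset V) : ℝ :=
  ∑ x ∈ X, ∑ y ∈ Y, if G.Adj x y then 1 else 0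

lemma adjPairs_comm (X Y : Finset V) : adjPairs G X Y = adjPairs G Y X := by
  unfold adjPairs
  rw [Finset.sum_comm]
  simp only [G.adj_comm]

lemma adjPairs_nonneg (X Y : Finset V) : 0 ≤ adjPairs G X Y := by
  unfold adjPairs
  positivity

lemma adjPairs_union_left {X Y : Finset V} (h : Disjoint X Y) (Z : Finset V) :
    adjPairs G (X ∪ Y) Z = adjPairs G X Z + adjPairs G Y Z := by
  unfold adjPairs
  rw [Finset.sum_union h]

lemma adjPairs_union_right {X Y : Finset V} (h : Disjoint X Y) (Z : Finset V) :
    adjPairs G Z (X ∪ Y) = adjPairs G Z X + adjPairs G Z Y := by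
  rw [adjPairs_comm, adjPairs_union_left G h, adjPairs_comm G X, adjPairs_comm G Y]

lemma adjPairs_eq_zero {X Y : Finset V} (h : ∀ x ∈ X, ∀ y ∈ Y, ¬ G.Adj x y) :
    adjPairs G X Y = 0 :=
  Finset.sum_eq_zero fun x hx => Finset.sum_eq_zero fun y hy => if_neg (h x hx y hy)

lemma adjPairs_le_mul (X Y : Finset V) : adjPairs G X Y ≤ (#X : ℝ) * #Y := by
  unfold adjPairs
  calc _ ≤ ∑ x ∈ X, ∑ y ∈ Y, (1 : ℝ) := by
        refine Finset.sum_le_sum fun x _ => Finset.sum_le_sum fun y _ => ?_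
        split_ifs <;> norm_num
    _ = _ := by simp

lemma adjPairs_self_le (X : Finset V) : adjPairs G X X ≤ (#X : ℝ) * #X - #X := by
  have h : ∀ x ∈ X, (∑ y ∈ X, if G.Adj x y then (1 : ℝ) else 0) ≤ (#X : ℝ) - 1 := by
    intro x hx
    rw [← Finset.add_sum_erase X _ hx, if_neg (G.irrefl), zero_add]
    calc _ ≤ ∑ y ∈ X.erase x, (1 : ℝ) := by
          refine Finset.sum_le_sum fun y _ => ?_
          split_ifs <;> norm_num
      _ = _ := by
          rw [Finset.sum_const, nsmul_eq_mul, mul_one, Finset.cast_card_erase_of_mem hx]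
  calc _ ≤ ∑ x ∈ X, ((#X : ℝ) - 1) := Finset.sum_le_sum h
    _ = _ := by rw [Finset.sum_const, nsmul_eq_mul]; ring

lemma adjPairs_univ [Fintype V] :
    adjPairs G univ univ = 2 * (G.edgeSet.ncard : ℝ) := by
  have h := G.sum_degrees_eq_twice_card_edges
  rw [← Set.ncard_coe_finset, coe_edgeFinset] at h
  rw [← Nat.cast_ofNat, ← Nat.cast_mul, ← h, Nat.cast_sum]
  unfold adjPairs
  refine Finset.sum_congr rfl fun x _ => ?_
  rw [Finset.sum_boole, ← card_neighborFinset_eq_degree, neighborFinset_eq_filter]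

/-- `S`, `A`, `B` partition `U`, and `S` separates the nonempty sets `A` and `B`. -/
structure IsSeparation (U S A B : Finset V) : Prop where
  union_eq : S ∪ A ∪ B = U
  disjoint_left : Disjoint S A
  disjoint_right : Disjoint S B
  disjoint : Disjoint A B
  left_nonempty : A.Nonempty
  right_nonempty : B.Nonempty
  not_adj : ∀ x ∈ A, ∀ y ∈ B, ¬ G.Adj x y

variable {G}

namespace IsSeparation

variable {U S A B : Finset V}

lemma symm (h : IsSeparation G U S A B) : IsSeparation G U S B A where
  union_eq := by rw [← h.union_eq, union_right_comm]
  disjoint_left := h.disjoint_right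
  disjoint_right := h.disjoint_left
  disjoint := h.disjoint.symm
  left_nonempty := h.right_nonempty
  right_nonempty := h.left_nonempty
  not_adj x hx y hy hxy := h.not_adj y hy x hx hxy.symm

lemma card_eq (h : IsSeparation G U S A B) : #U = #S + #A + #B := by
  rw [← h.union_eq, card_union_of_disjoint, card_union_of_disjoint h.disjoint_left]
  exact disjoint_union_left.2 ⟨h.disjoint_right, h.disjoint⟩

lemma adjPairs_eq (h : IsSeparation G U S A B) :
    adjPairs G U U = adjPairs G (S ∪ B) (S ∪ B) + 2 * adjPairs G A S + adjPairs G A A := by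
  have hd : Disjoint (S ∪ A) B := disjoint_union_left.2 ⟨h.disjoint_right, h.disjoint⟩
  have h0 := adjPairs_eq_zero G h.not_adj
  rw [← h.union_eq]
  simp only [adjPairs_union_left G hd, adjPairs_union_left G h.disjoint_left,
    adjPairs_union_left G h.disjoint_right, adjPairs_union_right G hd,
    adjPairs_union_right G h.disjoint_left, adjPairs_union_right G h.disjoint_right,
    adjPairs_comm G B A, adjPairs_comm G S A, h0]
  ring

lemma adjPairs_add (h : IsSeparation G U S A B) :
    adjPairs G U U + adjPairs G S S =
      adjPairs G (S ∪ A) (S ∪ A) + adjPairs G (S ∪ B) (S ∪ B) := by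
  rw [h.adjPairs_eq]
  simp only [adjPairs_union_left G h.disjoint_left, adjPairs_union_right G h.disjoint_left,
    adjPairs_comm G S A]
  ring

lemma card_union_right (h : IsSeparation G U S A B) : #(S ∪ B) = #S + #B :=
  card_union_of_disjoint h.disjoint_right

/-- A separation can be enlarged to one of any prescribed order that leaves two vertices. -/
lemma exists_card_eq (h : IsSeparation G U S A B) {k : ℕ} (hS : #S ≤ k) (hU : k + 2 ≤ #U) :
    ∃ S' A' B', IsSeparation G U S' A' B' ∧ #S' = k := by
  have hc := h.card_eq
  have hA := h.left_nonempty.card_pos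
  have hB := h.right_nonempty.card_pos
  obtain ⟨a, b, ha, hb, ha', hb', hab⟩ :
      ∃ a b, a ≤ #A ∧ b ≤ #B ∧ 1 ≤ a ∧ 1 ≤ b ∧ k + a + b = #U := by
    by_cases hl : #U - k - 1 ≤ #A
    · exact ⟨#U - k - 1, 1, by omega, by omega, by omega, by omega, by omega⟩
    · exact ⟨#A, #U - k - #A, by omega, by omega, by omega, by omega, by omega⟩
  obtain ⟨A', hA', rfl⟩ := exists_subset_card_eq ha
  obtain ⟨B', hB', rfl⟩ := exists_subset_card_eq hb
  have hAU : A' ⊆ U := fun x hx => by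
    rw [← h.union_eq]; simp [hA' hx]
  have hBU : B' ⊆ U := fun x hx => by
    rw [← h.union_eq]; simp [hB' hx]
  have hd : Disjoint A' B' := Finset.disjoint_of_subset_left hA'
    (Finset.disjoint_of_subset_right hB' h.disjoint)
  have hs : IsSeparation G U (U \ (A' ∪ B')) A' B' :=
    { union_eq := by
        rw [union_assoc]; exact sdiff_union_of_subset (union_subset hAU hBU)
      disjoint_left := Finset.disjoint_of_subset_right subset_union_left sdiff_disjoint
      disjoint_right := Finset.disjoint_of_subset_right subset_union_right sdiff_disjoint
      disjoint := hd
      left_nonempty := card_pos.1 ha'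
      right_nonempty := card_pos.1 hb'
      not_adj := fun x hx y hy => h.not_adj x (hA' hx) y (hB' hy) }
  exact ⟨_, A', B', hs, by have := hs.card_eq; omega⟩

/-- A separation may be ordered so that its second side is the larger one. -/
lemma exists_card_le (h : IsSeparation G U S A B) :
    ∃ A' B', IsSeparation G U S A' B' ∧ #A' ≤ #B' := by
  rcases le_total #A #B with hab | hab
  · exact ⟨A, B, h, hab⟩
  · exact ⟨B, A, h.symm, hab⟩

end IsSeparation

/-- A vertex set inducing no `k`-connected subgraph has a separation of order less than `k`. -/
lemma exists_isSeparation_of_not_kConnected {k : ℕ} {U : Finset V} (hU : k + 1 ≤ #U)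
    (h : ¬ KConnected k ((⊤ : G.Subgraph).induce (U : Set V)).coe) :
    ∃ S A B, IsSeparation G U S A B ∧ #S < k := by
  set H := (⊤ : G.Subgraph).induce (U : Set V) with hH
  have hv : H.verts = (U : Set V) := rfl
  have : Finite H.verts := by rw [hv]; exact U.finite_toSet
  unfold KConnected at h
  push Not at h
  obtain ⟨T, hT, hcon⟩ := h
  have hcard : T.ncard + Tᶜ.ncard = #U := by
    rw [Set.ncard_add_ncard_compl, ← Set.ncard_coe_finset U, ← hv]
    rfl
  have hncon : ¬ (H.coe.induce Tᶜ).Connected := fun hc => by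
    have := hcon hc
    omega
  have hne : Tᶜ.Nonempty := by
    rw [← Set.ncard_pos]; omega
  have : Nonempty (Tᶜ : Set H.verts) := hne.to_subtype
  have hpre : ¬ (H.coe.induce Tᶜ).Preconnected := fun hp => hncon ⟨hp⟩
  unfold SimpleGraph.Preconnected at hpre
  push Not at hpre
  obtain ⟨x, y, hxy⟩ := hpre
  let A : Finset V := U.filter fun v =>
    ∃ z : (Tᶜ : Set H.verts), (z : V) = v ∧ (H.coe.induce Tᶜ).Reachable x z
  let B : Finset V := U.filter fun v =>
    ∃ z : (Tᶜ : Set H.verts), (z : V) = v ∧ ¬ (H.coe.induce Tᶜ).Reachable x z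
  have hmem : ∀ z : (Tᶜ : Set H.verts), (z : V) ∈ U := fun z => z.1.2
  have hd : Disjoint A B := by
    rw [Finset.disjoint_left]
    intro v hA hB
    obtain ⟨z, rfl, hz⟩ := (mem_filter.1 hA).2
    obtain ⟨w, hw, hw'⟩ := (mem_filter.1 hB).2
    rw [Subtype.ext (Subtype.ext hw)] at hw'
    exact hw' hz
  refine ⟨U \ (A ∪ B), A, B, ?_, ?_⟩
  · exact
    { union_eq := by
        rw [union_assoc]
        exact sdiff_union_of_subset (union_subset (filter_subset _ _) (filter_subset _ _))
      disjoint_left := Finset.disjoint_of_subset_right subset_union_left sdiff_disjoint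
      disjoint_right := Finset.disjoint_of_subset_right subset_union_right sdiff_disjoint
      disjoint := hd
      left_nonempty := ⟨x, mem_filter.2 ⟨hmem x, x, rfl, Reachable.refl x⟩⟩
      right_nonempty := ⟨y, mem_filter.2 ⟨hmem y, y, rfl, hxy⟩⟩
      not_adj := by
        intro v hA w hB hvw
        obtain ⟨z, rfl, hz⟩ := (mem_filter.1 hA).2
        obtain ⟨z', rfl, hz'⟩ := (mem_filter.1 hB).2
        refine hz' (hz.trans (Adj.reachable ?_))
        exact ⟨hmem z, hmem z', hvw⟩ }
  · refine lt_of_le_of_lt ?_ hT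
    rw [← Set.ncard_coe_finset, ← Set.ncard_image_of_injective T Subtype.val_injective]
    refine Set.ncard_le_ncard ?_ (Set.toFinite _)
    intro v hv'
    obtain ⟨hvU, hvAB⟩ := mem_sdiff.1 (mem_coe.1 hv')
    by_contra hvT
    have hz : (⟨v, hvU⟩ : H.verts) ∈ Tᶜ := fun hz => hvT ⟨_, hz, rfl⟩
    apply hvAB
    by_cases hr : (H.coe.induce Tᶜ).Reachable x ⟨_, hz⟩
    · exact mem_union_left _ (mem_filter.2 ⟨hvU, ⟨_, hz⟩, rfl, hr⟩)
    · exact mem_union_right _ (mem_filter.2 ⟨hvU, ⟨_, hz⟩, rfl, hr⟩)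

variable {k : ℕ}

lemma exists_isSeparation_card_eq
    (hsep : ∀ U : Finset V, k + 1 ≤ #U → ∃ S A B, IsSeparation G U S A B ∧ #S < k)
    {U : Finset V} (hU : k + 2 ≤ #U) :
    ∃ S A B, IsSeparation G U S A B ∧ #S = k ∧ #A ≤ #B := by
  obtain ⟨S, A, B, h, hS⟩ := hsep U (by omega)
  obtain ⟨S, A, B, h, hS⟩ := h.exists_card_eq hS.le hU
  obtain ⟨A, B, h, hab⟩ := h.exists_card_le
  exact ⟨S, A, B, h, hS, hab⟩

/-- Without `k`-connected subgraphs, `n ≥ k` vertices miss at least `(n - k)² / 3` edges. -/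
lemma adjPairs_self_le_sq_sub
    (hsep : ∀ U : Finset V, k + 1 ≤ #U → ∃ S A B, IsSeparation G U S A B ∧ #S < k)
    (U : Finset V) (hU : k ≤ #U) :
    adjPairs G U U ≤ (#U : ℝ) ^ 2 - 2 / 3 * ((#U : ℝ) - k) ^ 2 := by
  induction U using Finset.strongInductionOn with
  | _ U ih =>
  have h1 := adjPairs_self_le G U
  rcases lt_or_ge #U (k + 2) with hlt | hge
  · have h0 : (0 : ℝ) ≤ k := Nat.cast_nonneg k
    obtain hk | hk : #U = k ∨ #U = k + 1 := by omega
    · rw [hk] at h1 ⊢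
      nlinarith
    · rw [hk] at h1 ⊢
      push_cast at h1 ⊢
      nlinarith
  · obtain ⟨S, A, B, h, hS, hab⟩ := exists_isSeparation_card_eq hsep hge
    have hA := h.left_nonempty.card_pos
    have hc := h.card_eq
    have hcB := h.card_union_right
    have hsub : S ∪ B ⊂ U := by
      refine Finset.ssubset_iff_subset_ne.2 ⟨?_, fun he => ?_⟩
      · rw [← h.union_eq, union_right_comm]
        exact subset_union_left
      · rw [he] at hcB
        omega
    have hi := ih _ hsub (by omega)
    have h2 := adjPairs_le_mul G A S
    have h3 := adjPairs_le_mul G A A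
    rw [h.adjPairs_eq]
    rw [hcB, hS] at hi
    rw [hS] at h2
    rw [hc, hS]
    have hab' : (#A : ℝ) ≤ #B := by exact_mod_cast hab
    have ha0 : (0 : ℝ) ≤ #A := Nat.cast_nonneg _
    push_cast at hi ⊢
    nlinarith [mul_nonneg ha0 (sub_nonneg.2 hab')]

lemma adjPairs_self_le_of_card_le
    (hsep : ∀ U : Finset V, k + 1 ≤ #U → ∃ S A B, IsSeparation G U S A B ∧ #S < k)
    (A : Finset V) (hA : (#A : ℝ) ≤ 5 / 4 * k) :
    adjPairs G A A ≤ 73 / 60 * k * #A := by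
  have ha0 : (0 : ℝ) ≤ #A := Nat.cast_nonneg _
  have hk0 : (0 : ℝ) ≤ k := Nat.cast_nonneg _
  rcases le_total k #A with h | h
  · have h1 := adjPairs_self_le_sq_sub hsep A h
    nlinarith [mul_nonneg (sub_nonneg.2 hA) (by positivity : (0 : ℝ) ≤ #A + 8 / 5 * k)]
  · have h1 := adjPairs_le_mul G A A
    have h' : (#A : ℝ) ≤ k := by exact_mod_cast h
    nlinarith [mul_nonneg ha0 (sub_nonneg.2 h')]

/-- Without `k`-connected subgraphs, `n ≥ 9k/4` vertices span at most `193/120 * k * (n - k)`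
edges. -/
lemma adjPairs_self_le_mul_sub (hk : 1 ≤ k)
    (hsep : ∀ U : Finset V, k + 1 ≤ #U → ∃ S A B, IsSeparation G U S A B ∧ #S < k)
    (U : Finset V) (hU : 9 / 4 * (k : ℝ) ≤ #U) :
    adjPairs G U U ≤ 193 / 60 * k * (#U - k) := by
  induction U using Finset.strongInductionOn with
  | _ U ih =>
  have hU' : 9 * k ≤ 4 * #U := by
    have : (9 : ℝ) * k ≤ 4 * #U := by linarith
    exact_mod_cast this
  have hk0 : (1 : ℝ) ≤ k := by exact_mod_cast hk
  obtain ⟨S, A, B, h, hS, hab⟩ := exists_isSeparation_card_eq hsep (U := U) (by omega)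
  have hA := h.left_nonempty.card_pos
  have hB := h.right_nonempty.card_pos
  have hc := h.card_eq
  have hcB := h.card_union_right
  have hcA := h.symm.card_union_right
  have hsB : S ∪ B ⊂ U := by
    refine Finset.ssubset_iff_subset_ne.2 ⟨?_, fun he => ?_⟩
    · rw [← h.union_eq, union_right_comm]
      exact subset_union_left
    · rw [he] at hcB
      omega
  have hsA : S ∪ A ⊂ U := by
    refine Finset.ssubset_iff_subset_ne.2 ⟨?_, fun he => ?_⟩
    · rw [← h.union_eq]
      exact subset_union_left
    · rw [he] at hcA
      omega
  have hab' : (#A : ℝ) ≤ #B := by exact_mod_cast hab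
  have ha0 : (0 : ℝ) ≤ #A := Nat.cast_nonneg _
  have hcR : (#U : ℝ) = k + #A + #B := by rw [hc, hS]; push_cast; ring
  have hcBR : (#(S ∪ B) : ℝ) = k + #B := by rw [hcB, hS]; push_cast; ring
  have hcAR : (#(S ∪ A) : ℝ) = k + #A := by rw [hcA, hS]; push_cast; ring
  have hAS := adjPairs_le_mul G A S
  rw [hS] at hAS
  have heq := h.adjPairs_eq
  rcases le_total (5 / 4 * (k : ℝ)) #B with hb | hb
  · have hiB := ih _ hsB (by rw [hcBR]; linarith)
    rw [hcBR] at hiB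
    rw [hcR]
    rcases le_total (5 / 4 * (k : ℝ)) #A with ha | ha
    · have hiA := ih _ hsA (by rw [hcAR]; linarith)
      rw [hcAR] at hiA
      have := h.adjPairs_add
      have := adjPairs_nonneg G S S
      linarith
    · have := adjPairs_self_le_of_card_le hsep A ha
      linarith
  · rcases le_total (#U : ℝ) (17 / 5 * k) with hu | hu
    · have h1 := adjPairs_self_le_sq_sub hsep U (by omega)
      nlinarith [mul_nonneg (sub_nonneg.2 hu) (sub_nonneg.2 hU)]
    · have hBk := adjPairs_self_le_sq_sub hsep (S ∪ B) (by omega)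
      have hAk : k ≤ #A := by
        have : (k : ℝ) ≤ #A := by linarith
        exact_mod_cast this
      have h1 := adjPairs_self_le_sq_sub hsep A hAk
      rw [hcBR] at hBk
      rw [hcR] at hu ⊢
      set a : ℝ := (#A : ℝ)
      set b : ℝ := (#B : ℝ)
      set c : ℝ := (k : ℝ)
      nlinarith [mul_nonneg (sub_nonneg.2 hb) (sub_nonneg.2 hab'),
        mul_nonneg (sub_nonneg.2 hb) (sub_nonneg.2 hu),
        mul_nonneg (sub_nonneg.2 hab') (sub_nonneg.2 hu),
        mul_nonneg (sub_nonneg.2 (hab'.trans hb)) (sub_nonneg.2 hu),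
        mul_nonneg (sub_nonneg.2 (hab'.trans hb)) (sub_nonneg.2 hb)]

end PairCount

/-- **Corollary 7.** A graph of order `n ≥ 1` with average degree `d̄ = 2|E(G)|/n`
contains a `⌊60 d̄ / 193⌋`-connected subgraph, provided `⌊60 d̄ / 193⌋ ≥ 1`. -/
theorem kconn_subgraph_of_avg_degree {V : Type*} [Fintype V] (G : SimpleGraph V)
    (hn : 1 ≤ Fintype.card V) (k : ℕ)
    (hk : k = ⌊60 * (2 * (G.edgeSet.ncard : ℝ) / (Fintype.card V : ℝ)) / 193⌋₊)
    (hk1 : 1 ≤ k) :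
    ∃ H : G.Subgraph, KConnected k H.coe := by
  by_contra! hno
  have hsep : ∀ U : Finset V, k + 1 ≤ U.card →
      ∃ S A B, IsSeparation G U S A B ∧ S.card < k :=
    fun U hU => exists_isSeparation_of_not_kConnected hU (hno _)
  have hn0 : (0 : ℝ) < Fintype.card V := by exact_mod_cast hn
  have hk0 : (1 : ℝ) ≤ k := by exact_mod_cast hk1
  have hfl : (k : ℝ) ≤ 60 * (2 * (G.edgeSet.ncard : ℝ) / (Fintype.card V : ℝ)) / 193 := by
    rw [hk]
    exact Nat.floor_le (by positivity)
  have he : 193 / 60 * (k : ℝ) * Fintype.card V ≤ adjPairs G Finset.univ Finset.univ := by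
    rw [adjPairs_univ, ← le_div_iff₀ hn0]
    linarith
  have hsq := adjPairs_le_mul G Finset.univ Finset.univ
  rw [Finset.card_univ] at hsq
  have hcard : 193 / 60 * (k : ℝ) ≤ Fintype.card V :=
    le_of_mul_le_mul_right (he.trans hsq) hn0
  have hmain := adjPairs_self_le_mul_sub hk1 hsep Finset.univ
    (by rw [Finset.card_univ]; linarith)
  rw [Finset.card_univ] at hmain
  nlinarith
end

section
/- Let G be a connected finite simple graph of order n with minimum degree δ(G) ≥ √n. Then every vertex x of G has at least two neighbors that are not cut-vertices of G. -/
open SimpleGraph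

/-- A vertex `v` of `G` is a cut-vertex if the graph `G - v` obtained by
deleting `v` is disconnected. -/
def IsCutVertex {V : Type*} (G : SimpleGraph V) (v : V) : Prop :=
  ¬ (G.induce ({v}ᶜ : Set V)).Connected

/-- The vertices other than `y` that `y` separates from `x`: every walk from `x` to them
passes through `y`. -/
def separatedBy {V : Type*} (G : SimpleGraph V) (x y : V) : Set V :=
  {v | v ≠ y ∧ ∀ p : G.Walk x v, y ∈ p.support}

lemma IsCutVertex.separatedBy_nonempty {V : Type*} {G : SimpleGraph V} {x y : V}
    (hy : IsCutVertex G y) (hxy : x ≠ y) : (separatedBy G x y).Nonempty := by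
  by_contra hne
  refine hy ((connected_iff_exists_forall_reachable _).2 ⟨⟨x, hxy⟩, fun ⟨v, hv⟩ ↦ ?_⟩)
  obtain ⟨p, hp⟩ : ∃ p : G.Walk x v, y ∉ p.support := by
    by_contra! h
    exact hne ⟨v, hv, h⟩
  exact ⟨p.induce _ fun w hw (hwy : w = y) ↦ hp (hwy ▸ hw)⟩

lemma mem_separatedBy_of_adj {V : Type*} {G : SimpleGraph V} {x y v w : V}
    (hv : v ∈ separatedBy G x y) (hvw : G.Adj v w) (hwy : w ≠ y) : w ∈ separatedBy G x y := by
  refine ⟨hwy, fun p ↦ ?_⟩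
  have h := hv.2 (p.concat hvw.symm)
  rw [Walk.support_concat] at h
  simpa [hv.1.symm] using h

lemma self_notMem_separatedBy {V : Type*} {G : SimpleGraph V} {x y : V} :
    x ∉ separatedBy G x y := by
  rintro ⟨hxy, h⟩
  have := h Walk.nil
  simp_all

lemma notMem_separatedBy_of_adj {V : Type*} {G : SimpleGraph V} {x y w : V}
    (hxy : G.Adj x y) (hxw : G.Adj x w) : w ∉ separatedBy G x y := fun hw ↦
  self_notMem_separatedBy (mem_separatedBy_of_adj hw hxw.symm hxy.ne)

/-- A neighbour of `x` separating `v` from `x` is the second vertex of any shortest walk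
from `x` to `v`, hence unique. -/
lemma eq_of_mem_separatedBy {V : Type*} {G : SimpleGraph V} (hG : G.Connected) {x y z v : V}
    (hxy : G.Adj x y) (hxz : G.Adj x z) (hy : v ∈ separatedBy G x y)
    (hz : v ∈ separatedBy G x z) : y = z := by
  obtain ⟨p, hp⟩ := hG.exists_walk_length_eq_dist x v
  cases p with
  | nil => exact absurd hy self_notMem_separatedBy
  | @cons _ u _ hxu q =>
    have key : ∀ t, G.Adj x t → v ∈ separatedBy G x t → t = u := by
      classical
      intro t hxt ht
      have hmem : t ∈ q.support := by
        have := ht.2 (Walk.cons hxu q)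
        simpa [hxt.ne'] using this
      by_contra htu
      have h₁ := dist_le (Walk.cons hxt (q.dropUntil t hmem))
      have h₂ := congrArg Walk.length (q.take_spec hmem)
      have h₃ : (q.takeUntil t hmem).length ≠ 0 := fun h ↦
        htu (Walk.eq_of_length_eq_zero h).symm
      simp only [Walk.length_append, Walk.length_cons] at h₁ h₂ hp
      omega
    rw [key y hxy hy, key z hxz hz]

lemma minDegree_le_ncard_separatedBy {V : Type*} [Fintype V] {G : SimpleGraph V}
    [DecidableRel G.Adj] {x y : V} (hy : IsCutVertex G y) (hxy : x ≠ y) :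
    G.minDegree ≤ (separatedBy G x y).ncard := by
  classical
  obtain ⟨v, hv⟩ := hy.separatedBy_nonempty hxy
  have hsub : ((insert v (G.neighborFinset v) : Finset V) : Set V) ⊆
      insert y (separatedBy G x y) := by
    intro w hw
    rw [Finset.mem_coe, Finset.mem_insert, mem_neighborFinset] at hw
    rcases hw with rfl | hw
    · exact Or.inr hv
    · by_cases hwy : w = y
      · exact Or.inl hwy
      · exact Or.inr (mem_separatedBy_of_adj hv hw hwy)
  have h₁ := Set.ncard_le_ncard hsub (Set.toFinite _)
  rw [Set.ncard_coe_finset, Finset.card_insert_of_notMem (by simp), card_neighborFinset_eq_degree]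
    at h₁
  have h₂ := Set.ncard_insert_le y (separatedBy G x y)
  have h₃ := G.minDegree_le_degree v
  omega

/-- **Claim 2.3.** If `G` is connected of order `n` with `δ(G) ≥ √n`, then every vertex
has at least two neighbours that are not cut-vertices. -/
theorem two_noncut_neighbors {V : Type*} [Fintype V]
    (G : SimpleGraph V) [DecidableRel G.Adj] (hconn : G.Connected)
    (hδ : (G.minDegree : ℝ) ≥ Real.sqrt (Fintype.card V : ℝ)) :
    ∀ x : V, 2 ≤ {y : V | G.Adj x y ∧ ¬ IsCutVertex G y}.ncard := by
  classical
  intro x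
  have hn : Fintype.card V ≤ G.minDegree ^ 2 := by
    exact_mod_cast (Real.sqrt_le_left (Nat.cast_nonneg _)).1 hδ
  have hnoncut : {y : V | G.Adj x y ∧ ¬ IsCutVertex G y} =
      ((G.neighborFinset x).filter fun y ↦ ¬ IsCutVertex G y : Finset V) := by
    ext; simp
  rw [hnoncut, Set.ncard_coe_finset]
  by_contra! hlt
  set T := (G.neighborFinset x).filter fun y ↦ IsCutVertex G y with hT
  have hadj : ∀ y ∈ T, G.Adj x y := fun y hy ↦ by simp_all
  have hsplit := Finset.card_filter_add_card_filter_not (s := G.neighborFinset x)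
    (fun y ↦ IsCutVertex G y)
  rw [card_neighborFinset_eq_degree, ← hT] at hsplit
  set U := T.biUnion fun y ↦ (separatedBy G x y).toFinset with hU
  have hUcard : T.card * G.minDegree ≤ U.card := by
    rw [hU, Finset.card_biUnion, ← smul_eq_mul]
    · refine Finset.card_nsmul_le_sum _ _ _ fun y hy ↦ ?_
      rw [← Set.ncard_eq_toFinset_card']
      exact minDegree_le_ncard_separatedBy (Finset.mem_filter.1 hy).2 (hadj y hy).ne
    · intro y hy z hz hyz
      refine Finset.disjoint_left.2 fun v hvy hvz ↦ ?_
      rw [Set.mem_toFinset] at hvy hvz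
      exact hyz (eq_of_mem_separatedBy hconn (hadj y hy) (hadj z hz) hvy hvz)
  have hdisj : Disjoint U (insert x (G.neighborFinset x)) := by
    rw [Finset.disjoint_left]
    intro v hv hvx
    obtain ⟨y, hy, hvy⟩ := Finset.mem_biUnion.1 hv
    rw [Set.mem_toFinset] at hvy
    rw [Finset.mem_insert, mem_neighborFinset] at hvx
    rcases hvx with rfl | hvx
    · exact self_notMem_separatedBy hvy
    · exact notMem_separatedBy_of_adj (hadj y hy) hvx hvy
  have htotal := Finset.card_le_univ (U ∪ insert x (G.neighborFinset x))
  rw [Finset.card_union_of_disjoint hdisj, Finset.card_insert_of_notMem (by simp),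
    card_neighborFinset_eq_degree] at htotal
  have hdeg := G.minDegree_le_degree x
  have hTcard : G.minDegree ≤ T.card + 1 := by omega
  nlinarith [Nat.mul_le_mul_right G.minDegree hTcard]
end

section
/- Let G be a connected finite simple graph of order n with minimum degree δ(G) ≥ √n such that every block of G has order at most 2δ(G) − 1. Let B be a block of G, let X_B be the set of vertices of B that are not cut-vertices of G, suppose X_B ≠ ∅, and let x ∈ V(B) be a cut-vertex of G. Then there exists a block C of the graph B − x with X_B ⊆ V(C). -/
open SimpleGraph

/-- A subgraph `B` of `G` is a block if it is a bridge (an edge lying on no cycle,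
together with its two endpoints) or a maximal `2`-connected subgraph of `G`. -/
def IsBlock {V : Type*} (G : SimpleGraph V) (B : G.Subgraph) : Prop :=
  (∃ (u v : V) (h : G.Adj u v), G.IsBridge s(u, v) ∧ B = G.subgraphOfAdj h) ∨
  (KConnected 2 B.coe ∧ ∀ B' : G.Subgraph, B ≤ B' → KConnected 2 B'.coe → B' = B)

/-- `G.LinkedIn A u v` says that some walk from `u` to `v` stays inside `A`. -/
def SimpleGraph.LinkedIn {V : Type*} (G : SimpleGraph V) (A : Set V) (u v : V) : Prop :=
  ∃ p : G.Walk u v, ∀ t ∈ p.support, t ∈ A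

/-- A set of vertices which stays connected after deleting any at most one vertex. -/
def SimpleGraph.IsUnseparated {V : Type*} (G : SimpleGraph V) (S : Set V) : Prop :=
  ∀ W : Set V, W.Subsingleton → ∀ y ∈ S \ W, ∀ z ∈ S \ W, G.LinkedIn (S \ W) y z

section

variable {V : Type*} {G : SimpleGraph V}

namespace SimpleGraph.LinkedIn

variable {A A' : Set V} {u v w : V}

lemma refl (h : u ∈ A) : G.LinkedIn A u u := ⟨.nil, by simpa using h⟩

lemma symm (h : G.LinkedIn A u v) : G.LinkedIn A v u := by
  obtain ⟨p, hp⟩ := h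
  exact ⟨p.reverse, by simpa using hp⟩

lemma trans (h : G.LinkedIn A u v) (h' : G.LinkedIn A v w) : G.LinkedIn A u w := by
  obtain ⟨p, hp⟩ := h
  obtain ⟨q, hq⟩ := h'
  refine ⟨p.append q, fun t ht => ?_⟩
  rcases (Walk.mem_support_append_iff _ _).1 ht with ht | ht
  exacts [hp t ht, hq t ht]

lemma mono (hA : A ⊆ A') (h : G.LinkedIn A u v) : G.LinkedIn A' u v := by
  obtain ⟨p, hp⟩ := h
  exact ⟨p, fun t ht => hA (hp t ht)⟩

lemma of_adj (h : G.Adj u v) (hu : u ∈ A) (hv : v ∈ A) : G.LinkedIn A u v :=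
  ⟨h.toWalk, by simp [hu, hv]⟩

end SimpleGraph.LinkedIn

/-- After deleting at most one vertex, every vertex left on a path is still joined to an end. -/
lemma SimpleGraph.Walk.IsPath.linkedIn_end {a b t : V} {p : G.Walk a b} (hp : p.IsPath)
    (ht : t ∈ p.support) {W : Set V} (hW : W.Subsingleton) (htW : t ∉ W) :
    (a ∉ W ∧ G.LinkedIn ({s | s ∈ p.support} \ W) t a) ∨
      (b ∉ W ∧ G.LinkedIn ({s | s ∈ p.support} \ W) t b) := by
  classical
  by_cases h : ∃ w ∈ W, w ∈ (p.takeUntil t ht).support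
  · obtain ⟨w, hwW, hw⟩ := h
    have key : ∀ s ∈ (p.dropUntil t ht).support, s ∉ W := by
      intro s hs hsW
      obtain rfl : s = w := hW hsW hwW
      have hst : s ≠ t := fun h => htW (h ▸ hsW)
      have hnd := hp.support_nodup
      rw [← p.take_spec ht, Walk.support_append] at hnd
      refine (List.disjoint_of_nodup_append hnd) hw ?_
      rw [Walk.mem_support_iff] at hs
      exact hs.resolve_left hst
    exact .inr ⟨key _ (Walk.end_mem_support _), p.dropUntil t ht,
      fun s hs => ⟨p.support_dropUntil_subset_support ht hs, key s hs⟩⟩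
  · push Not at h
    have h' : ∀ s ∈ (p.takeUntil t ht).support, s ∉ W := fun s hs hsW => h s hsW hs
    exact .inl ⟨h' _ (Walk.start_mem_support _), .symm ⟨p.takeUntil t ht,
      fun s hs => ⟨p.support_takeUntil_subset_support ht hs, h' s hs⟩⟩⟩

/-- Adding an ear preserves being unseparated. -/
lemma SimpleGraph.IsUnseparated.union_path {S : Set V} (hS : G.IsUnseparated S) {a b : V}
    (ha : a ∈ S) (hb : b ∈ S) {p : G.Walk a b} (hp : p.IsPath) :
    G.IsUnseparated (S ∪ {s | s ∈ p.support}) := by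
  intro W hW
  have key : ∀ y ∈ (S ∪ {s | s ∈ p.support}) \ W,
      ∃ c ∈ S \ W, G.LinkedIn ((S ∪ {s | s ∈ p.support}) \ W) y c := by
    rintro y ⟨hy | hy, hyW⟩
    · exact ⟨y, ⟨hy, hyW⟩, .refl ⟨.inl hy, hyW⟩⟩
    · have hsub : {s | s ∈ p.support} \ W ⊆ (S ∪ {s | s ∈ p.support}) \ W :=
        Set.sdiff_subset_sdiff_left Set.subset_union_right
      rcases hp.linkedIn_end hy hW hyW with ⟨h, h'⟩ | ⟨h, h'⟩
      exacts [⟨a, ⟨ha, h⟩, h'.mono hsub⟩, ⟨b, ⟨hb, h⟩, h'.mono hsub⟩]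
  intro y hy z hz
  obtain ⟨c, hc, hyc⟩ := key y hy
  obtain ⟨d, hd, hzd⟩ := key z hz
  exact hyc.trans (((hS W hW c hc d hd).mono
    (Set.sdiff_subset_sdiff_left Set.subset_union_left)).trans hzd.symm)

lemma SimpleGraph.Adj.isUnseparated {u v : V} (h : G.Adj u v) : G.IsUnseparated {u, v} := by
  rintro W hW y hy z hz
  rcases hy with ⟨rfl | rfl, hyW⟩ <;> rcases hz with ⟨rfl | rfl, hzW⟩
  · exact .refl ⟨by simp, hyW⟩
  · exact .of_adj h ⟨by simp, hyW⟩ ⟨by simp, hzW⟩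
  · exact .of_adj h.symm ⟨by simp, hyW⟩ ⟨by simp, hzW⟩
  · exact .refl ⟨by simp, hyW⟩

lemma SimpleGraph.Walk.exists_eq_of_mem_support_map {V' : Type*} {G' : SimpleGraph V'} {u v : V}
    (p : G.Walk u v) (f : G →g G') {t : V'} (ht : t ∈ (p.map f).support) : ∃ s, f s = t := by
  rw [Walk.support_map, List.mem_map] at ht
  obtain ⟨s, -, hs⟩ := ht
  exact ⟨s, hs⟩

lemma exists_walk_of_not_isCutVertex {u v w : V} (h : ¬ IsCutVertex G u) (hv : v ≠ u)
    (hw : w ≠ u) : ∃ p : G.Walk v w, u ∉ p.support := by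
  obtain ⟨p⟩ := (not_not.1 h).preconnected ⟨v, hv⟩ ⟨w, hw⟩
  refine ⟨p.map (Embedding.induce _).toHom, fun hu => ?_⟩
  obtain ⟨s, hs⟩ := p.exists_eq_of_mem_support_map _ hu
  exact s.2 hs

lemma KConnected.isUnseparated_verts [Finite V] {B : G.Subgraph} (h : KConnected 2 B.coe) :
    G.IsUnseparated B.verts := by
  rintro W hW y ⟨hy, hyW⟩ z ⟨hz, hzW⟩
  have hsub : (Subtype.val ⁻¹' W : Set B.verts).Subsingleton :=
    hW.preimage Subtype.val_injective
  obtain ⟨p⟩ := (h _ (Nat.lt_succ_of_le (Set.ncard_le_one_iff_subsingleton.2 hsub))).1.preconnected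
    ⟨⟨y, hy⟩, hyW⟩ ⟨⟨z, hz⟩, hzW⟩
  refine ⟨p.map (B.hom.comp (Embedding.induce _).toHom), fun t ht => ?_⟩
  obtain ⟨⟨⟨s, hs⟩, hsW⟩, rfl⟩ := p.exists_eq_of_mem_support_map _ ht
  exact ⟨hs, hsW⟩

lemma KConnected.two_lt_ncard_verts [Finite V] {B : G.Subgraph} (h : KConnected 2 B.coe) :
    2 < B.verts.ncard := by
  obtain ⟨⟨a, -⟩⟩ := (h ∅ (by simp)).1.nonempty
  have h2 := (h {a} (by simp)).2
  have h3 := Set.ncard_add_ncard_compl ({a} : Set B.verts)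
  rw [Set.ncard_singleton, Nat.card_coe_set_eq] at h3
  omega

lemma SimpleGraph.IsUnseparated.kConnected_two [Finite V] {S : Set V} (h : G.IsUnseparated S)
    (hS : 2 < S.ncard) : KConnected 2 ((⊤ : G.Subgraph).induce S).coe := by
  intro W hW
  have hcard : 2 ≤ Wᶜ.ncard := by
    have h3 := Set.ncard_add_ncard_compl W
    have h4 : Nat.card ((⊤ : G.Subgraph).induce S).verts = S.ncard := Nat.card_coe_set_eq S
    omega
  have hW' : (Subtype.val '' W : Set V).Subsingleton :=
    (Set.ncard_le_one_iff_subsingleton.1 (Nat.le_of_lt_succ hW)).image _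
  have hmem : ∀ y, (hy : y ∈ S) → (⟨y, hy⟩ : ((⊤ : G.Subgraph).induce S).verts) ∉ W →
      y ∈ S \ Subtype.val '' W := by
    rintro y hy hyW
    refine ⟨hy, ?_⟩
    rintro ⟨z, hz, rfl⟩
    exact hyW hz
  refine ⟨?_, hcard⟩
  have : Nonempty (Wᶜ : Set _) :=
    (Set.nonempty_of_ncard_ne_zero (by omega : Wᶜ.ncard ≠ 0)).to_subtype
  refine ⟨?_⟩
  rintro ⟨⟨y, hy⟩, hyW⟩ ⟨⟨z, hz⟩, hzW⟩
  obtain ⟨p, hp⟩ := h _ hW' y (hmem y hy hyW) z (hmem z hz hzW)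
  let f : G.induce (S \ Subtype.val '' W) →g
      ((⊤ : G.Subgraph).induce S).coe.induce Wᶜ :=
    { toFun := fun t => ⟨⟨t.1, t.2.1⟩, fun ht => t.2.2 ⟨_, ht, rfl⟩⟩
      map_rel' := fun {a b} hab => ⟨a.2.1, b.2.1, hab⟩ }
  exact ⟨(p.induce _ hp).map f⟩

/-- An unseparated set of at least three vertices lies in a block. -/
lemma SimpleGraph.IsUnseparated.exists_isBlock [Finite V] {S : Set V} (h : G.IsUnseparated S)
    (hS : 2 < S.ncard) : ∃ C : G.Subgraph, IsBlock G C ∧ S ⊆ C.verts := by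
  obtain ⟨M, hSM, hM⟩ := (Set.toFinite {T : Set V | G.IsUnseparated T}).exists_le_maximal h
  have hMc : 2 < M.ncard := hS.trans_le (Set.ncard_le_ncard hSM)
  refine ⟨(⊤ : G.Subgraph).induce M, .inr ⟨hM.prop.kConnected_two hMc, ?_⟩, hSM⟩
  intro B' hB' hc
  have hv : B'.verts ⊆ M := hM.le_of_ge hc.isUnseparated_verts hB'.1
  have hle : B' ≤ (⊤ : G.Subgraph).induce M :=
    ⟨hv, fun _ _ hab => ⟨hv hab.fst_mem, hv hab.snd_mem, hab.adj_sub⟩⟩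
  exact le_antisymm hle hB'

/-- Every edge lies in a block. -/
lemma SimpleGraph.Adj.exists_isBlock [Finite V] {u v : V} (h : G.Adj u v) :
    ∃ C : G.Subgraph, IsBlock G C ∧ u ∈ C.verts ∧ v ∈ C.verts := by
  classical
  by_cases hb : G.IsBridge s(u, v)
  · exact ⟨G.subgraphOfAdj h, .inl ⟨u, v, h, hb, rfl⟩, by simp, by simp⟩
  rw [isBridge_iff_forall_walk_mem_edges] at hb
  push Not at hb
  obtain ⟨p, hp⟩ := hb
  have hq : s(u, v) ∉ (p.toPath : G.Walk u v).edges := fun h => hp (p.edges_toPath_subset_edges h)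
  have hU := h.isUnseparated.union_path (by simp) (by simp) p.toPath.2
  obtain ⟨C, hC, hsub⟩ := hU.exists_isBlock (by
    rw [Set.two_lt_ncard_iff]
    generalize (p.toPath : G.Walk u v) = q at hq
    cases q with
    | nil => exact absurd h (G.irrefl)
    | @cons _ t _ hut r =>
      refine ⟨u, v, t, by simp, by simp, .inr (by simp), h.ne, hut.ne, ?_⟩
      rintro rfl
      simp at hq)
  exact ⟨C, hC, hsub (by simp), hsub (by simp)⟩

/-- Vertices which no single vertex separates pairwise lie in a common unseparated set. -/
lemma SimpleGraph.isUnseparated_of_pairwise {X : Set V} {a b : V} (ha : a ∈ X) (hb : b ∈ X)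
    (hab : a ≠ b) (h : ∀ u ∈ X, ∀ v ∈ X, ∀ W : Set V, W.Subsingleton → u ∉ W → v ∉ W →
      G.LinkedIn Wᶜ u v) :
    ∃ S, X ⊆ S ∧ G.IsUnseparated S := by
  refine ⟨{z | ∀ W : Set V, W.Subsingleton → z ∉ W → ∀ u ∈ X, u ∉ W → G.LinkedIn Wᶜ z u},
    fun u hu W hW huW v hv hvW => h u hu v hv W hW huW hvW, ?_⟩
  classical
  rintro W hW y ⟨hy, hyW⟩ z ⟨hz, hzW⟩
  obtain ⟨c, hc, hcW⟩ : ∃ c ∈ X, c ∉ W := by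
    by_contra! hcon
    exact hab (hW (hcon a ha) (hcon b hb))
  obtain ⟨p, hp⟩ := (hy W hW hyW c hc hcW).trans (hz W hW hzW c hc hcW).symm
  refine ⟨p.toPath, fun t ht => ⟨fun W' hW' htW' u hu huW' => ?_,
    hp t (p.support_toPath_subset_support ht)⟩⟩
  rcases p.toPath.2.linkedIn_end ht hW' htW' with ⟨h1, h2⟩ | ⟨h1, h2⟩
  · exact (h2.mono fun s hs => hs.2).trans (hy W' hW' h1 u hu huW')
  · exact (h2.mono fun s hs => hs.2).trans (hz W' hW' h1 u hu huW')

/-- In a graph on at most `2m` vertices, two vertices of degree at least `m` are not separated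
by a single vertex. -/
lemma SimpleGraph.linkedIn_compl_of_card_le [Finite V] {m : ℕ} (hm : Nat.card V ≤ 2 * m)
    {u v : V} (hu : m ≤ (G.neighborSet u).ncard) (hv : m ≤ (G.neighborSet v).ncard)
    {W : Set V} (hW : W.Subsingleton) (huW : u ∉ W) (hvW : v ∉ W) : G.LinkedIn Wᶜ u v := by
  have hlink : ∀ a, a ∉ W → ∀ t ∈ insert a (G.neighborSet a) \ W, G.LinkedIn Wᶜ a t := by
    rintro a haW t ⟨rfl | ht, htW⟩
    exacts [.refl haW, .of_adj ht haW htW]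
  have hcard : ∀ a, m ≤ (G.neighborSet a).ncard →
      m + 1 ≤ (insert a (G.neighborSet a) \ W).ncard + W.ncard := by
    intro a ha
    have h1 := Set.ncard_le_ncard_sdiff_add_ncard (insert a (G.neighborSet a)) W
    rw [Set.ncard_insert_of_notMem (by simp)] at h1
    omega
  by_contra hcon
  have hd : Disjoint (insert u (G.neighborSet u) \ W) (insert v (G.neighborSet v) \ W) :=
    Set.disjoint_left.2 fun t ht ht' => hcon ((hlink u huW t ht).trans (hlink v hvW t ht').symm)
  have hd' : Disjoint (insert u (G.neighborSet u) \ W ∪ insert v (G.neighborSet v) \ W) W :=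
    Set.disjoint_union_left.2 ⟨Set.disjoint_sdiff_left, Set.disjoint_sdiff_left⟩
  have h1 := Set.ncard_union_eq hd
  have h2 := Set.ncard_union_eq hd'
  have h3 := Set.ncard_le_card (insert u (G.neighborSet u) \ W ∪ insert v (G.neighborSet v) \ W ∪ W)
  have h4 := hcard u hu
  have h5 := hcard v hv
  have h6 := Set.ncard_le_one_iff_subsingleton.2 hW
  omega

/-- In a graph on at most `2m` vertices, all vertices of degree at least `m` lie in a common
block. -/
lemma SimpleGraph.exists_isBlock_of_card_le [Finite V] {m : ℕ} (hm0 : m ≠ 0)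
    (hm : Nat.card V ≤ 2 * m) {X : Set V} (hX : X.Nonempty)
    (hdeg : ∀ u ∈ X, m ≤ (G.neighborSet u).ncard) :
    ∃ C : G.Subgraph, IsBlock G C ∧ X ⊆ C.verts := by
  obtain ⟨a, ha⟩ := hX
  have hedge : ∀ Y : Set V, (∀ b, G.Adj a b → Y ⊆ {a, b} → ∃ C : G.Subgraph, IsBlock G C ∧
      Y ⊆ C.verts) := by
    intro Y b hab hY
    obtain ⟨C, hC, h1, h2⟩ := hab.exists_isBlock
    exact ⟨C, hC, hY.trans (Set.pair_subset h1 h2)⟩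
  by_cases hX1 : ∃ b ∈ X, a ≠ b
  · obtain ⟨b, hb, hab⟩ := hX1
    obtain ⟨S, hXS, hS⟩ := isUnseparated_of_pairwise (G := G) ha hb hab
      fun u hu v hv W hW huW hvW =>
        linkedIn_compl_of_card_le hm (hdeg u hu) (hdeg v hv) hW huW hvW
    by_cases hS2 : 2 < S.ncard
    · obtain ⟨C, hC, hSC⟩ := hS.exists_isBlock hS2
      exact ⟨C, hC, hXS.trans hSC⟩
    have hSab : {a, b} = S := Set.eq_of_subset_of_ncard_le
      (Set.pair_subset (hXS ha) (hXS hb)) (by rw [Set.ncard_pair hab]; omega)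
    obtain ⟨p, hp⟩ := hS ∅ Set.subsingleton_empty a ⟨hXS ha, by simp⟩ b ⟨hXS hb, by simp⟩
    refine hedge X b ?_ (hSab ▸ hXS)
    cases p with
    | nil => exact absurd rfl hab
    | @cons _ t _ hat q =>
      have ht := (hp t (by simp)).1
      rw [← hSab] at ht
      rcases ht with rfl | rfl
      exacts [absurd hat G.irrefl, hat]
  · push Not at hX1
    obtain ⟨b, hb⟩ := Set.nonempty_of_ncard_ne_zero
      (by have := hdeg a ha; omega : (G.neighborSet a).ncard ≠ 0)
    exact hedge X b hb fun t ht => .inl (hX1 t ht).symm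

/-- If an end of a bridge is not a cut-vertex, then it has no further neighbours. -/
lemma SimpleGraph.IsBridge.eq_of_not_isCutVertex {u v t : V} (hb : G.IsBridge s(u, v))
    (hcut : ¬ IsCutVertex G u) (huv : G.Adj u v) (hut : G.Adj u t) : t = v := by
  by_contra htv
  obtain ⟨p, hp⟩ := exists_walk_of_not_isCutVertex hcut hut.ne' huv.ne'
  have hmem := isBridge_iff_forall_walk_mem_edges.1 hb (.cons hut p)
  rw [Walk.edges_cons, List.mem_cons] at hmem
  rcases hmem with h | h
  · exact htv (Sym2.congr_right.1 h).symm
  · exact hp (Walk.fst_mem_support_of_mem_edges _ h)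

lemma induce_eq_of_maximal [Finite V] {B : G.Subgraph} (hB : KConnected 2 B.coe)
    (hmax : ∀ B' : G.Subgraph, B ≤ B' → KConnected 2 B'.coe → B' = B)
    {S : Set V} (hS : G.IsUnseparated S) (hBS : B.verts ⊆ S) :
    (⊤ : G.Subgraph).induce S = B :=
  hmax _ ⟨hBS, fun _ _ hab => ⟨hBS hab.fst_mem, hBS hab.snd_mem, hab.adj_sub⟩⟩
    (hS.kConnected_two (hB.two_lt_ncard_verts.trans_le (Set.ncard_le_ncard hBS)))

/-- In a maximal `2`-connected subgraph, all edges of `G` at a vertex which is not a cut-vertex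
are present. -/
lemma adj_of_maximal [Finite V] {B : G.Subgraph} (hB : KConnected 2 B.coe)
    (hmax : ∀ B' : G.Subgraph, B ≤ B' → KConnected 2 B'.coe → B' = B)
    {u v : V} (hu : u ∈ B.verts) (hcut : ¬ IsCutVertex G u)
    (huv : G.Adj u v) : B.Adj u v := by
  classical
  have hv : v ∈ B.verts := by
    obtain ⟨b, hb, hbu⟩ := Set.exists_ne_of_one_lt_ncard
      (by have := hB.two_lt_ncard_verts; omega : 1 < B.verts.ncard) u
    obtain ⟨q, hq⟩ := exists_walk_of_not_isCutVertex hcut huv.ne' hbu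
    have hpath : (Walk.cons huv q.toPath.1).IsPath :=
      q.toPath.2.cons fun h => hq (q.support_toPath_subset_support h)
    have heq := induce_eq_of_maximal hB hmax
      (hB.isUnseparated_verts.union_path hu hb hpath) Set.subset_union_left
    rw [← heq]
    exact .inr (by simp)
  rw [← induce_eq_of_maximal hB hmax hB.isUnseparated_verts subset_rfl]
  exact ⟨hu, hv, huv⟩

end

/-- **Claim 2.4.** Suppose `G` is connected of order `n` with `δ(G) ≥ √n` and every block
of `G` has order at most `2δ(G) - 1`. If `B` is a block with `X_B ≠ ∅` and `x ∈ V(B)` is a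
cut-vertex of `G`, then some block `C` of `B - x` satisfies `X_B ⊆ V(C)`. -/
theorem block_containing_XB {V : Type*} [Fintype V]
    (G : SimpleGraph V) [DecidableRel G.Adj] (hconn : G.Connected)
    (hδ : (G.minDegree : ℝ) ≥ Real.sqrt (Fintype.card V : ℝ))
    (hblocks : ∀ B : G.Subgraph, IsBlock G B → B.verts.ncard ≤ 2 * G.minDegree - 1)
    (B : G.Subgraph) (hB : IsBlock G B)
    (hXB : {y : V | y ∈ B.verts ∧ ¬ IsCutVertex G y}.Nonempty)
    (x : V) (hx : x ∈ B.verts) (hcut : IsCutVertex G x) :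
    ∃ C : ((B.deleteVerts {x}).coe).Subgraph, IsBlock (B.deleteVerts {x}).coe C ∧
      ∀ y ∈ B.verts, ¬ IsCutVertex G y →
        ∃ h : y ∈ (B.deleteVerts {x}).verts,
          (⟨y, h⟩ : ↑(B.deleteVerts {x}).verts) ∈ C.verts := by
  have hcardN : ∀ u, G.minDegree ≤ (G.neighborSet u).ncard := fun u => by
    rw [← Nat.card_coe_set_eq, Nat.card_eq_fintype_card, card_neighborSet_eq_degree]
    exact G.minDegree_le_degree u
  have hBcard := hblocks B hB
  obtain ⟨y₀, hy₀, hy₀cut⟩ := hXB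
  rcases hB with ⟨a, b, hab, hbr, rfl⟩ | ⟨hB, hmax⟩
  · exfalso
    have hone : ∀ u v, G.Adj u v → G.IsBridge s(u, v) → ¬ IsCutVertex G u →
        G.minDegree ≤ 1 := by
      intro u v huv hb hcut
      have hsub : G.neighborSet u ⊆ {v} := fun t ht => hb.eq_of_not_isCutVertex hcut huv ht
      simpa using (hcardN u).trans (Set.ncard_le_ncard hsub)
    have hδ1 : G.minDegree ≤ 1 := by
      rcases hy₀ with rfl | rfl
      · exact hone _ _ hab hbr hy₀cut
      · exact hone _ _ hab.symm (by rwa [Sym2.eq_swap]) hy₀cut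
    have h2 : (G.subgraphOfAdj hab).verts.ncard = 2 := Set.ncard_pair hab.ne
    omega
  have h3 := hB.two_lt_ncard_verts
  have hxcard : (B.deleteVerts {x}).verts.ncard + 1 = B.verts.ncard :=
    Set.ncard_sdiff_singleton_add_one hx
  have hmem : ∀ y ∈ B.verts, ¬ IsCutVertex G y → y ∈ (B.deleteVerts {x}).verts :=
    fun y hy hyc => ⟨hy, fun h => hyc (h ▸ hcut)⟩
  obtain ⟨C, hC, hXC⟩ := exists_isBlock_of_card_le (G := (B.deleteVerts {x}).coe)
    (m := G.minDegree - 1) (X := {y | ¬ IsCutVertex G y.1}) (by omega)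
    (by rw [Nat.card_coe_set_eq]; omega) ⟨⟨y₀, hmem y₀ hy₀ hy₀cut⟩, hy₀cut⟩ (by
      rintro ⟨u, hu⟩ hucut
      have hsub : G.neighborSet u \ {x} ⊆
          Subtype.val '' ((B.deleteVerts {x}).coe.neighborSet ⟨u, hu⟩) := by
        rintro t ⟨ht, htx⟩
        have hadj := adj_of_maximal hB hmax hu.1 hucut ht
        exact ⟨⟨t, hadj.snd_mem, htx⟩,
          Subgraph.deleteVerts_adj.2 ⟨hu.1, hu.2, hadj.snd_mem, htx, hadj⟩, rfl⟩
      have h4 := Set.ncard_le_ncard hsub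
      rw [Set.ncard_image_of_injective _ Subtype.val_injective] at h4
      have h5 := Set.ncard_le_ncard_sdiff_add_ncard (G.neighborSet u) {x}
      rw [Set.ncard_singleton] at h5
      have h6 := hcardN u
      omega)
  exact ⟨C, hC, fun y hy hyc => ⟨hmem y hy hyc, hXC hyc⟩⟩
end

section
/- Let k ≥ 1 be an integer, let G1 and G2 be vertex-disjoint k-connected finite simple graphs, and let M be a set of k pairwise non-adjacent edges (a matching of size k), each joining a vertex of G1 to a vertex of G2. Then the graph obtained from the disjoint union of G1 and G2 by adding the edges of M is k-connected. -/
open SimpleGraph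

/-- A set that is too small to meet all of the pairwise disjoint pairs
`{inl (f i), inr (g i)}` misses both elements of one of them. -/
lemma exists_inl_notMem_inr_notMem_of_ncard_lt {α β ι : Type*} [Finite α] [Finite β]
    {f : ι → α} {g : ι → β} (hf : Function.Injective f) (hg : Function.Injective g)
    {S : Set (α ⊕ β)} (hS : S.ncard < Nat.card ι) :
    ∃ i, Sum.inl (f i) ∉ S ∧ Sum.inr (g i) ∉ S := by
  classical
  by_contra! h
  let φ : ι → S := fun i =>
    if hi : Sum.inl (f i) ∈ S then ⟨Sum.inl (f i), hi⟩ else ⟨Sum.inr (g i), h i hi⟩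
  have hφ : Function.Injective φ := by
    intro i j hij
    by_cases hi : Sum.inl (f i) ∈ S <;> by_cases hj : Sum.inl (f j) ∈ S <;>
      simp only [φ, hi, hj, dite_true, dite_false, Subtype.mk.injEq, Sum.inl.injEq,
        Sum.inr.injEq, reduceCtorEq] at hij
    · exact hf hij
    · exact hg hij
  have := Nat.card_le_card_of_injective φ hφ
  rw [Nat.card_coe_set_eq] at this
  omega

/-- Joining two `k`-connected graphs by a matching of size `k` yields a `k`-connected
graph. The matching is given by injective maps `f`, `g` picking the endpoints of the
`k` pairwise non-adjacent edges. -/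
theorem kconn_of_union_matching {α β : Type*} [Fintype α] [Fintype β]
    (k : ℕ) (hk : 1 ≤ k) (G₁ : SimpleGraph α) (G₂ : SimpleGraph β)
    (h₁ : KConnected k G₁) (h₂ : KConnected k G₂)
    (f : Fin k → α) (g : Fin k → β)
    (hf : Function.Injective f) (hg : Function.Injective g) :
    KConnected k ((G₁ ⊕g G₂) ⊔
      SimpleGraph.fromRel (fun x y => ∃ i : Fin k,
        x = Sum.inl (f i) ∧ y = Sum.inr (g i))) := by
  intro S hS
  have hA : (Sum.inl ⁻¹' S : Set α).ncard < k :=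
    (Set.ncard_le_ncard_of_injOn Sum.inl (fun _ h => h) Sum.inl_injective.injOn).trans_lt hS
  have hB : (Sum.inr ⁻¹' S : Set β).ncard < k :=
    (Set.ncard_le_ncard_of_injOn Sum.inr (fun _ h => h) Sum.inr_injective.injOn).trans_lt hS
  obtain ⟨hc₁, hn₁⟩ := h₁ _ hA
  obtain ⟨hc₂, -⟩ := h₂ _ hB
  obtain ⟨i, hfi, hgi⟩ :=
    exists_inl_notMem_inr_notMem_of_ncard_lt hf hg (S := S) (by simpa using hS)
  refine ⟨?_, hn₁.trans
    (Set.ncard_le_ncard_of_injOn Sum.inl (fun _ h => h) Sum.inl_injective.injOn)⟩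
  set G := (G₁ ⊕g G₂) ⊔ SimpleGraph.fromRel (fun x y => ∃ i : Fin k,
    x = Sum.inl (f i) ∧ y = Sum.inr (g i))
  let φ₁ : G₁.induce (Sum.inl ⁻¹' S)ᶜ →g G.induce Sᶜ :=
    ⟨fun x => ⟨Sum.inl x.1, x.2⟩, fun {x y} h => Or.inl (sum_adj_inl.2 h)⟩
  let φ₂ : G₂.induce (Sum.inr ⁻¹' S)ᶜ →g G.induce Sᶜ :=
    ⟨fun x => ⟨Sum.inr x.1, x.2⟩, fun {x y} h => Or.inl (sum_adj_inr.2 h)⟩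
  have hadj : (G.induce Sᶜ).Adj ⟨Sum.inl (f i), hfi⟩ ⟨Sum.inr (g i), hgi⟩ :=
    Or.inr ((fromRel_adj _ _ _).2 ⟨Sum.inl_ne_inr, Or.inl ⟨i, rfl, rfl⟩⟩)
  refine (connected_iff_exists_forall_reachable _).2 ⟨⟨Sum.inl (f i), hfi⟩, ?_⟩
  rintro ⟨a | b, hx⟩
  · exact (hc₁.preconnected ⟨f i, hfi⟩ ⟨a, hx⟩).map φ₁
  · exact hadj.reachable.trans ((hc₂.preconnected ⟨g i, hgi⟩ ⟨b, hx⟩).map φ₂)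
end
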